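/- Let K be an algebraically closed field of characteristic 0, G a reductive algebraic group over K, and H a closed subgroup of G of maximal reductive rank. Then every homomorphism of algebraic groups from H to a unipotent algebraic group over K is trivial. -/

import Mathlib

open Matrix MvPolynomial

variable {K : Type} [Field K]

/-- The entries and inverse-entries of an element of `GL (Fin n) K`, as a valuation of
variables; used to express Zariski-closedness and polynomiality on `GL n`. -/
def matOf {n : ℕ} (A : GL (Fin n) K) : (Fin n × Fin n) ⊕ (Fin n × Fin n) → K :=
  Sum.elim (fun q => (A : Matrix (Fin n) (Fin n) K) q.1 q.2)
           (fun q => ((A⁻¹ : GL (Fin n) K) : Matrix (Fin n) (Fin n) K) q.1 q.2)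

/-- A subset of `GL n K` is Zariski closed if it is the common zero locus of a family of
polynomials in the matrix entries and the entries of the inverse matrix. -/
def IsZClosed {n : ℕ} (s : Set (GL (Fin n) K)) : Prop :=
  ∃ I : Set (MvPolynomial ((Fin n × Fin n) ⊕ (Fin n × Fin n)) K),
    s = {A | ∀ p ∈ I, eval (matOf A) p = 0}

/-- A subgroup of `GL n K` is connected (for the Zariski topology). -/
def IsConnectedSG {n : ℕ} (H : Subgroup (GL (Fin n) K)) : Prop :=
  ∀ s t : Set (GL (Fin n) K), IsZClosed s → IsZClosed t →
    (H : Set (GL (Fin n) K)) ⊆ s ∪ t → (H : Set (GL (Fin n) K)) ∩ s ∩ t = ∅ →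
    (H : Set (GL (Fin n) K)) ⊆ s ∨ (H : Set (GL (Fin n) K)) ⊆ t

/-- A function on a subgroup of `GL n K` is a polynomial (regular) function if it is given by
a polynomial in the matrix entries and inverse-matrix entries. -/
def IsPolyFun {n : ℕ} (H : Subgroup (GL (Fin n) K)) (f : H → K) : Prop :=
  ∃ p : MvPolynomial ((Fin n × Fin n) ⊕ (Fin n × Fin n)) K,
    ∀ A : H, f A = eval (matOf (A : GL (Fin n) K)) p

/-- A homomorphism of linear algebraic groups: a group homomorphism which is regular. -/
structure AlgGroupHom {n m : ℕ} (H : Subgroup (GL (Fin n) K)) (H' : Subgroup (GL (Fin m) K)) where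
  toFun : H →* H'
  poly : ∀ i j : Fin m,
    IsPolyFun H (fun A => ((toFun A : GL (Fin m) K) : Matrix (Fin m) (Fin m) K) i j)

/-- A homomorphism of algebraic groups from `H` to the additive group `G_a`. -/
structure GaHom {n : ℕ} (H : Subgroup (GL (Fin n) K)) where
  toFun : H → K
  map_mul : ∀ A B : H, toFun (A * B) = toFun A + toFun B
  poly : IsPolyFun H toFun

/-- Base change `GL n K → GL n K̄`. -/
noncomputable def glBaseChange {n : ℕ} : GL (Fin n) K →* GL (Fin n) (AlgebraicClosure K) :=
  Units.map ((algebraMap K (AlgebraicClosure K)).mapMatrix.toMonoidHom)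

/-- A torus: a Zariski-closed connected subgroup which is diagonalizable over the algebraic
closure. -/
def IsTorus {n : ℕ} (T : Subgroup (GL (Fin n) K)) : Prop :=
  IsZClosed (T : Set (GL (Fin n) K)) ∧ IsConnectedSG T ∧
  ∃ g : GL (Fin n) (AlgebraicClosure K), ∀ A ∈ T,
    Matrix.IsDiag
      ((g * glBaseChange A * g⁻¹ : GL (Fin n) (AlgebraicClosure K)) :
        Matrix (Fin n) (Fin n) (AlgebraicClosure K))

/-- `T` is a maximal torus of `G`. -/
def IsMaximalTorus {n : ℕ} (G T : Subgroup (GL (Fin n) K)) : Prop :=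
  IsTorus T ∧ T ≤ G ∧
    ∀ T' : Subgroup (GL (Fin n) K), IsTorus T' → T' ≤ G → T ≤ T' → T' = T

/-- A unipotent element of `GL n K`. -/
def IsUnipotentElt {n : ℕ} (A : GL (Fin n) K) : Prop :=
  ((A : Matrix (Fin n) (Fin n) K) - 1) ^ n = 0

/-- A (connected) reductive group: closed, connected, with trivial unipotent radical, i.e.
every Zariski-closed connected normal subgroup consisting of unipotent elements is trivial. -/
def IsReductive {n : ℕ} (G : Subgroup (GL (Fin n) K)) : Prop :=
  IsZClosed (G : Set (GL (Fin n) K)) ∧ IsConnectedSG G ∧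
  ∀ U : Subgroup (GL (Fin n) K), U ≤ G → IsZClosed (U : Set (GL (Fin n) K)) →
    IsConnectedSG U → (∀ g ∈ G, ∀ u ∈ U, g * u * g⁻¹ ∈ U) →
    (∀ u ∈ U, IsUnipotentElt u) → U = ⊥

/-- A torus has rank `r` if it is isomorphic, as an algebraic group, to `G_m^r`. -/
def TorusHasRank {n : ℕ} (T : Subgroup (GL (Fin n) K)) (r : ℕ) : Prop :=
  ∃ e : T ≃* (Fin r → Kˣ),
    (∀ i : Fin r, IsPolyFun T (fun A => ((e A i : Kˣ) : K))) ∧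
    (∀ i j : Fin n, ∃ p : MvPolynomial (Fin r ⊕ Fin r) K, ∀ v : Fin r → Kˣ,
      (((e.symm v : T) : GL (Fin n) K) : Matrix (Fin n) (Fin n) K) i j =
        eval (Sum.elim (fun k => ((v k : Kˣ) : K)) (fun k => (((v k)⁻¹ : Kˣ) : K))) p)

/-- The reductive rank of `G` is `r`: some maximal torus of `G` has rank `r`. -/
def HasRedRank {n : ℕ} (G : Subgroup (GL (Fin n) K)) (r : ℕ) : Prop :=
  ∃ T : Subgroup (GL (Fin n) K), IsMaximalTorus G T ∧ TorusHasRank T r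

set_option linter.unusedSectionVars false

section Translations

variable {ι : Type} [Fintype ι] [DecidableEq ι]

/-- Evaluation of a polynomial in the matrix entries at a matrix. -/
noncomputable def matEval (A : Matrix ι ι K) : MvPolynomial (ι × ι) K →ₐ[K] K :=
  aeval fun q => A q.1 q.2

/-- Right translation by `B`: the polynomial `p` is sent to `A ↦ p (A * B)`. -/
noncomputable def rightTrans (B : Matrix ι ι K) :
    MvPolynomial (ι × ι) K →ₐ[K] MvPolynomial (ι × ι) K :=
  aeval fun q => ∑ k, X (q.1, k) * C (B k q.2)

/-- The left invariant derivation attached to the matrix `x`. -/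
noncomputable def rightDer (x : Matrix ι ι K) :
    Derivation K (MvPolynomial (ι × ι) K) (MvPolynomial (ι × ι) K) :=
  mkDerivation K fun q => ∑ k, X (q.1, k) * C (x k q.2)

@[simp] lemma matEval_X (A : Matrix ι ι K) (q : ι × ι) : matEval A (X q) = A q.1 q.2 := by
  simp [matEval]

@[simp] lemma matEval_C (A : Matrix ι ι K) (c : K) : matEval A (C c) = c := by
  simp [matEval]

@[simp] lemma rightTrans_X (B : Matrix ι ι K) (q : ι × ι) :
    rightTrans B (X q) = ∑ k, X (q.1, k) * C (B k q.2) := by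
  simp [rightTrans]

@[simp] lemma rightTrans_C (B : Matrix ι ι K) (c : K) :
    rightTrans B (C c : MvPolynomial (ι × ι) K) = C c := by
  simp [rightTrans]

@[simp] lemma rightDer_X (x : Matrix ι ι K) (q : ι × ι) :
    rightDer x (X q) = ∑ k, X (q.1, k) * C (x k q.2) := by
  simp [rightDer, mkDerivation_X]

@[simp] lemma rightDer_C (x : Matrix ι ι K) (c : K) :
    rightDer x (C c : MvPolynomial (ι × ι) K) = 0 := by
  simp [rightDer]

lemma matEval_rightTrans (A B : Matrix ι ι K) (p : MvPolynomial (ι × ι) K) :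
    matEval A (rightTrans B p) = matEval (A * B) p := by
  have : (matEval A).comp (rightTrans B) = matEval (A * B) := by
    ext q; simp [Matrix.mul_apply]
  exact DFunLike.congr_fun this p

lemma rightTrans_rightTrans (A B : Matrix ι ι K) (p : MvPolynomial (ι × ι) K) :
    rightTrans A (rightTrans B p) = rightTrans (A * B) p := by
  have : (rightTrans A).comp (rightTrans B) = rightTrans (A * B) := by
    apply MvPolynomial.algHom_ext
    intro q
    simp only [AlgHom.comp_apply, rightTrans_X, map_sum, map_mul, rightTrans_C, Matrix.mul_apply,
      Finset.sum_mul, Finset.mul_sum]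
    rw [Finset.sum_comm]
    simp only [mul_assoc]
  exact DFunLike.congr_fun this p

@[simp] lemma rightTrans_one (p : MvPolynomial (ι × ι) K) :
    rightTrans (1 : Matrix ι ι K) p = p := by
  have : rightTrans (1 : Matrix ι ι K) = AlgHom.id K _ := by
    apply MvPolynomial.algHom_ext
    rintro ⟨i, j⟩
    simp [Matrix.one_apply]
  simp [this]

lemma rightTrans_rightDer {A x y : Matrix ι ι K} (h : A * x = y * A)
    (p : MvPolynomial (ι × ι) K) :
    rightTrans A (rightDer x p) = rightDer y (rightTrans A p) := by
  induction p using MvPolynomial.induction_on with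
  | C a => simp
  | add p q hp hq => simp [hp, hq]
  | mul_X p q hp =>
    have hX : rightTrans A (rightDer x (X q)) = rightDer y (rightTrans A (X q)) := by
      have h' : ∀ i j, ∑ k, A i k * x k j = ∑ k, y i k * A k j := fun i j => by
        simpa [Matrix.mul_apply] using congrFun (congrFun h i) j
      simp only [rightDer_X, rightTrans_X, map_sum, map_mul, rightTrans_C, Derivation.leibniz,
        smul_eq_mul, rightDer_C, mul_zero, zero_add, Finset.sum_mul, Finset.mul_sum]
      rw [Finset.sum_comm]
      conv_rhs => rw [Finset.sum_comm]
      refine Finset.sum_congr rfl fun l _ => ?_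
      have := congrArg (fun c => X (q.1, l) * (C c : MvPolynomial (ι × ι) K)) (h' l q.2)
      simp only [map_sum, map_mul, Finset.mul_sum] at this
      convert this using 2 <;> ring
    simp only [Derivation.leibniz, map_mul, map_add, smul_eq_mul, hX, hp]

lemma rightDer_add (x y : Matrix ι ι K) : rightDer (x + y) = rightDer x + rightDer y := by
  apply MvPolynomial.derivation_ext
  intro q
  simp [mul_add, Finset.sum_add_distrib]

lemma rightDer_smul (c : K) (x : Matrix ι ι K) : rightDer (c • x) = c • rightDer x := by
  apply MvPolynomial.derivation_ext
  intro q
  simp only [rightDer_X, Derivation.smul_apply, Finset.smul_sum, Matrix.smul_apply, smul_eq_mul,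
    map_mul, MvPolynomial.smul_eq_C_mul]
  exact Finset.sum_congr rfl fun k _ => by ring

lemma rightDer_rightDer_X (x y : Matrix ι ι K) (q : ι × ι) :
    rightDer x (rightDer y (X q)) = rightDer (x * y) (X q) := by
  simp only [rightDer_X, map_sum, Derivation.leibniz, rightDer_C, mul_zero, zero_add, smul_eq_mul,
    Matrix.mul_apply, map_mul, Finset.mul_sum]
  rw [Finset.sum_comm]
  exact Finset.sum_congr rfl fun k _ => Finset.sum_congr rfl fun l _ => by ring

lemma rightDer_lie (x y : Matrix ι ι K) : rightDer (x * y - y * x) = ⁅rightDer x, rightDer y⁆ := by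
  apply MvPolynomial.derivation_ext
  intro q
  rw [Derivation.commutator_apply, rightDer_rightDer_X, rightDer_rightDer_X,
    sub_eq_add_neg, ← neg_one_smul K (y * x), rightDer_add, rightDer_smul]
  simp [sub_eq_add_neg]

lemma rightDer_comm {x y : Matrix ι ι K} (h : Commute x y) (p : MvPolynomial (ι × ι) K) :
    rightDer x (rightDer y p) = rightDer y (rightDer x p) := by
  have h0 : rightDer (x * y - y * x) = 0 := by
    rw [h.eq, sub_self]
    simpa using rightDer_smul (0 : K) (0 : Matrix ι ι K)
  have := DFunLike.congr_fun (rightDer_lie x y) p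
  rw [h0, Derivation.commutator_apply] at this
  exact (sub_eq_zero.mp this.symm)

/-- A twisted derivation which is nilpotent on the variables is locally nilpotent. -/
lemma exists_pow_apply_eq_zero {σ : Type} (f τ : Module.End K (MvPolynomial σ K))
    (hτ : Commute f τ)
    (hf : ∀ p q, f (p * q) = f p * τ q + p * f q) (hC : ∀ c, f (C c) = 0)
    (hX : ∀ i, ∃ k, (f ^ k) (X i) = 0) (p : MvPolynomial σ K) : ∃ k, (f ^ k) p = 0 := by
  have key : ∀ n a b, a + b = n → ∀ p q : MvPolynomial σ K, (f ^ a) p = 0 → (f ^ b) q = 0 →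
      (f ^ n) (p * q) = 0 := by
    intro n
    induction n with
    | zero =>
      intro a b hab p q hp hq
      obtain ⟨rfl, rfl⟩ : a = 0 ∧ b = 0 := by omega
      simp only [pow_zero, Module.End.one_apply] at hp ⊢
      simp [hp]
    | succ n ih =>
      intro a b hab p q hp hq
      rcases a with _ | a
      · simp only [pow_zero, Module.End.one_apply] at hp
        simp [hp]
      rcases b with _ | b
      · simp only [pow_zero, Module.End.one_apply] at hq
        simp [hq]
      rw [pow_succ, Module.End.mul_apply, hf, map_add,
        ih a (b + 1) (by omega) (f p) (τ q) (by rwa [pow_succ] at hp)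
          (by rw [← Module.End.mul_apply, (hτ.pow_left (b + 1)).eq, Module.End.mul_apply, hq,
            map_zero]),
        ih (a + 1) b (by omega) p (f q) hp (by rwa [pow_succ] at hq), add_zero]
  induction p using MvPolynomial.induction_on with
  | C a => exact ⟨1, by simp [hC]⟩
  | add p q hp hq =>
    obtain ⟨a, ha⟩ := hp
    obtain ⟨b, hb⟩ := hq
    refine ⟨a + b, ?_⟩
    rw [map_add, pow_add, Module.End.mul_apply, Module.End.mul_apply, hb, map_zero, add_zero,
      ← Module.End.mul_apply, (Commute.pow_pow_self f a b).eq, Module.End.mul_apply, ha, map_zero]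
  | mul_X p i hp =>
    obtain ⟨a, ha⟩ := hp
    obtain ⟨b, hb⟩ := hX i
    exact ⟨a + b, key _ a b rfl p _ ha hb⟩

lemma rightDer_locally_nilpotent {x : Matrix ι ι K} (hx : IsNilpotent x)
    (p : MvPolynomial (ι × ι) K) :
    ∃ k, (((rightDer x : _ →ₗ[K] _) : Module.End K (MvPolynomial (ι × ι) K)) ^ k) p = 0 := by
  obtain ⟨d, hd⟩ := hx
  refine exists_pow_apply_eq_zero _ 1 (Commute.one_right _) (fun p q => ?_) (fun c => ?_)
    (fun q => ⟨d, ?_⟩) p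
  · simp only [Derivation.coeFn_coe, Derivation.leibniz, smul_eq_mul, Module.End.one_apply]
    ring
  · simp
  · have : ∀ k, (((rightDer x : _ →ₗ[K] _) : Module.End K (MvPolynomial (ι × ι) K)) ^ k) (X q)
        = ∑ l, X (q.1, l) * C ((x ^ k) l q.2) := by
      intro k
      induction k with
      | zero => obtain ⟨i, j⟩ := q; simp [Matrix.one_apply]
      | succ k ih =>
        rw [pow_succ', Module.End.mul_apply, ih, ← rightDer_X, Derivation.coeFn_coe,
          rightDer_rightDer_X, rightDer_X, pow_succ']
    simp [this, hd]

lemma rightTrans_sub_one_locally_nilpotent {u : Matrix ι ι K} (hu : IsNilpotent (u - 1))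
    (p : MvPolynomial (ι × ι) K) :
    ∃ k, (((rightTrans u).toLinearMap - 1 : Module.End K (MvPolynomial (ι × ι) K)) ^ k) p = 0 := by
  obtain ⟨d, hd⟩ := hu
  refine exists_pow_apply_eq_zero _ (rightTrans u).toLinearMap
    ((Commute.refl _).sub_left (Commute.one_left _)) (fun p q => ?_) (fun c => ?_)
    (fun q => ⟨d, ?_⟩) p
  · simp only [LinearMap.sub_apply, AlgHom.toLinearMap_apply, map_mul, Module.End.one_apply]
    ring
  · simp
  · have : ∀ k, (((rightTrans u).toLinearMap - 1 : Module.End K (MvPolynomial (ι × ι) K)) ^ k)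
        (X q) = ∑ l, X (q.1, l) * C (((u - 1) ^ k) l q.2) := by
      intro k
      induction k with
      | zero => obtain ⟨i, j⟩ := q; simp [Matrix.one_apply]
      | succ k ih =>
        rw [pow_succ', Module.End.mul_apply, ih, ← rightDer_X, LinearMap.sub_apply,
          Module.End.one_apply, ← rightDer_X, pow_succ', ← rightDer_rightDer_X]
        have h1 : ∀ i : ι × ι, rightTrans u (X i : MvPolynomial (ι × ι) K)
            = rightDer (u - 1) (X i) + X i := by
          rintro ⟨i, j⟩
          simp [Matrix.sub_apply, mul_sub, Finset.sum_sub_distrib, Matrix.one_apply]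
        simp only [rightDer_X, map_sum, map_mul, AlgHom.toLinearMap_apply, rightTrans_C,
          Derivation.leibniz, rightDer_C, mul_zero, zero_add, h1, smul_eq_mul]
        rw [← Finset.sum_sub_distrib]
        exact Finset.sum_congr rfl fun l _ => by ring
    simp [this, hd]

/-- If a sum of generalized eigenvectors with distinct eigenvalues lies in an invariant subspace,
so does each summand. -/
lemma mem_of_sum_genEigenvectors_mem {W : Type*} [AddCommGroup W] [Module K W]
    (f : Module.End K W) (I : Submodule K W) (hI : ∀ x ∈ I, f x ∈ I) (s : Finset K) (q : K → W)
    (hq : ∀ μ ∈ s, ∃ k, ((f - algebraMap K (Module.End K W) μ) ^ k) (q μ) = 0) (h : ∑ μ ∈ s, q μ ∈ I) :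
    ∀ μ ∈ s, q μ ∈ I := by
  classical
  intro μ hμ
  choose! k hk using hq
  have hI' : ∀ P : Polynomial K, ∀ x ∈ I, Polynomial.aeval f P x ∈ I := by
    intro P x hx
    induction P using Polynomial.induction_on' with
    | add P Q hP hQ => simpa using I.add_mem hP hQ
    | monomial n a =>
      rw [Polynomial.aeval_monomial, Module.End.mul_apply, Module.algebraMap_end_apply]
      refine I.smul_mem _ ?_
      clear h
      induction n with
      | zero => simpa
      | succ n ih => rw [pow_succ', Module.End.mul_apply]; exact hI _ ih
  have hcop : IsCoprime (∏ ν ∈ s.erase μ, (Polynomial.X - Polynomial.C ν) ^ k ν)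
      ((Polynomial.X - Polynomial.C μ) ^ k μ) := by
    refine IsCoprime.prod_left fun ν hν => IsCoprime.pow ?_
    exact Polynomial.isCoprime_X_sub_C_of_isUnit_sub
      (sub_ne_zero.mpr (Finset.ne_of_mem_erase hν)).isUnit
  obtain ⟨a, b, hab⟩ := hcop
  have hkill : ∀ ν ∈ s, Polynomial.aeval f ((Polynomial.X - Polynomial.C ν) ^ k ν) (q ν) = 0 := by
    intro ν hν
    simpa using hk ν hν
  have h1 : q μ = Polynomial.aeval f (a * ∏ ν ∈ s.erase μ, (Polynomial.X - Polynomial.C ν) ^ k ν)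
      (∑ ν ∈ s, q ν) := by
    rw [map_sum, Finset.sum_eq_single_of_mem μ hμ]
    · have := congrArg (fun P => Polynomial.aeval f P (q μ)) hab
      simp only [map_add, LinearMap.add_apply, map_one, Module.End.one_apply] at this
      rw [map_mul _ b, Module.End.mul_apply, hkill μ hμ, map_zero, add_zero] at this
      exact this.symm
    · intro ν hν hνμ
      rw [← Finset.mul_prod_erase _ _ (Finset.mem_erase.mpr ⟨hνμ, hν⟩), mul_comm (_ ^ _), ← mul_assoc,
        map_mul, Module.End.mul_apply, hkill ν hν, map_zero]
  rw [h1]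
  exact hI' _ _ h

lemma stable_of_weights (g : Matrix ι ι K) (hg : IsUnit g) (I : Submodule K (MvPolynomial (ι × ι) K))
    (f Y : Module.End K (MvPolynomial (ι × ι) K)) (w c : (ι × ι →₀ ℕ) → K)
    (hf : ∀ m, ∃ k, ((f - algebraMap K (Module.End K (MvPolynomial (ι × ι) K)) (w m)) ^ k)
      (rightTrans g (monomial m 1)) = 0)
    (hY : ∀ m, Y (rightTrans g (monomial m 1)) = c m • rightTrans g (monomial m 1))
    (hwc : ∀ m m', w m = w m' → c m = c m') (hI : ∀ p ∈ I, f p ∈ I) : ∀ p ∈ I, Y p ∈ I := by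
  classical
  intro p hp
  obtain ⟨g', hg'⟩ := hg.exists_right_inv
  set p' := rightTrans g' p with hp'
  have hpp : p = ∑ m ∈ p'.support, coeff m p' • rightTrans g (monomial m 1) := by
    have : rightTrans g p' = p := by rw [hp', rightTrans_rightTrans, hg', rightTrans_one]
    conv_lhs => rw [← this, p'.as_sum, map_sum]
    refine Finset.sum_congr rfl fun m _ => ?_
    rw [← map_smul, smul_monomial, smul_eq_mul, mul_one]
  set s := p'.support.image w with hs
  set q : K → MvPolynomial (ι × ι) K := fun μ =>
    ∑ m ∈ p'.support with w m = μ, coeff m p' • rightTrans g (monomial m 1) with hq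
  have hsum : p = ∑ μ ∈ s, q μ := by
    rw [hpp]
    exact (Finset.sum_fiberwise_of_maps_to (fun m hm => Finset.mem_image_of_mem w hm) _).symm
  have hmem := mem_of_sum_genEigenvectors_mem f I hI s q (fun μ _ => by
    choose k hk using hf
    refine ⟨∑ m ∈ p'.support, k m, ?_⟩
    rw [hq]
    simp only [map_sum, map_smul]
    refine Finset.sum_eq_zero fun m hm => ?_
    obtain ⟨hms, rfl⟩ := Finset.mem_filter.mp hm
    rw [← Finset.sum_erase_add _ _ hms, pow_add, Module.End.mul_apply, hk, map_zero, smul_zero])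
    (hsum ▸ hp)
  rw [hsum, map_sum]
  refine I.sum_mem fun μ hμ => ?_
  obtain ⟨m₀, hm₀, rfl⟩ := Finset.mem_image.mp hμ
  have : Y (q (w m₀)) = c m₀ • q (w m₀) := by
    rw [hq]
    simp only [map_sum, map_smul, Finset.smul_sum]
    refine Finset.sum_congr rfl fun m hm => ?_
    rw [hY, hwc m m₀ (Finset.mem_filter.mp hm).2, smul_comm]
  rw [this]
  exact I.smul_mem _ (hmem _ hμ)

lemma rightTrans_diagonal_monomial (a : ι → K) (m : ι × ι →₀ ℕ) :
    rightTrans (diagonal a) (monomial m 1) = (m.prod fun q k => a q.2 ^ k) • monomial m (1 : K) := by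
  have hX : ∀ q : ι × ι, rightTrans (diagonal a) (X q) = C (a q.2) * X q := by
    rintro ⟨i, j⟩
    simp [Matrix.diagonal_apply, apply_ite C, mul_comm]
  rw [monomial_eq, map_mul, rightTrans_C, Finsupp.prod, map_prod]
  simp only [map_pow, hX, mul_pow, Finset.prod_mul_distrib, Finsupp.prod, smul_eq_C_mul, map_prod]
  ring

lemma rightDer_diagonal_monomial (a : ι → K) (m : ι × ι →₀ ℕ) :
    rightDer (diagonal a) (monomial m 1) = (m.sum fun q k => (k : K) * a q.2) • monomial m (1 : K) := by
  induction m using Finsupp.induction_linear with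
  | zero => 
    rw [Finsupp.sum_zero_index, zero_smul]
    exact rightDer_C _ 1
  | add m m' h h' =>
    have : monomial (m + m') (1 : K) = monomial m 1 * monomial m' 1 := by simp
    rw [this, Derivation.leibniz, h, h', Finsupp.sum_add_index']
    · simp only [smul_eq_mul, smul_eq_C_mul, map_add]; ring
    · simp
    · intros; push_cast; ring
  | single q k =>
    obtain ⟨i, j⟩ := q
    have : monomial (Finsupp.single (i, j) k) (1 : K) = X (i, j) ^ k := by
      rw [X_pow_eq_monomial]
    rw [this, Derivation.leibniz_pow, Finsupp.sum_single_index (by simp)]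
    rcases k with _ | k
    · simp
    · simp [Matrix.diagonal_apply, apply_ite C, smul_eq_C_mul, pow_succ]; ring

end Translations

section NilpotentExp

variable {A : Type*} [Ring A] [Algebra ℚ A]

lemma exists_exp_eq_one_add_add {x : A} (hx : IsNilpotent x) :
    ∃ c, Commute x c ∧ IsNilpotent.exp x = 1 + x + x ^ 2 * c := by
  obtain ⟨k, hk⟩ := hx
  refine ⟨∑ i ∈ Finset.range k, ((i + 2).factorial : ℚ)⁻¹ • x ^ i, ?_, ?_⟩
  · exact Commute.sum_right _ _ _ fun i _ => ((Commute.refl x).pow_right i).smul_right _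
  · rw [IsNilpotent.exp_eq_sum (k := k + 2) (by rw [pow_add, hk, zero_mul]), Finset.sum_range_succ',
      Finset.sum_range_succ', Finset.mul_sum]
    simp only [mul_smul_comm, ← pow_add]
    simp only [add_comm 2]
    simp
    abel

lemma eq_zero_of_exp_eq_one {x : A} (hx : IsNilpotent x) (h : IsNilpotent.exp x = 1) : x = 0 := by
  obtain ⟨c, hc, he⟩ := exists_exp_eq_one_add_add hx
  have hu : IsUnit (1 + x * c) := (hc.isNilpotent_mul_right hx).isUnit_one_add
  have h0 : x * (1 + x * c) = 0 := by
    rw [he] at h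
    have : x + x ^ 2 * c = 0 := by
      rw [add_assoc] at h
      exact add_eq_left.mp h
    rw [mul_add, mul_one, ← mul_assoc, ← pow_two, this]
  exact hu.mul_left_eq_zero.mp h0

lemma exists_exp_eq_of_commRing {B : Type*} [CommRing B] [Algebra ℚ B] {x : B}
    (hx : IsNilpotent x) : ∃ y, IsNilpotent y ∧ IsNilpotent.exp y = 1 + x := by
  have key : ∀ k : ℕ, ∃ y, x ∣ y ∧ x ^ (k + 1) ∣ IsNilpotent.exp y - (1 + x) := by
    intro k
    induction k with
    | zero => exact ⟨0, dvd_zero _, by simp⟩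
    | succ k ih =>
      obtain ⟨y, ⟨z, rfl⟩, a, ha⟩ := ih
      have hb : IsNilpotent (-(x ^ (k + 1) * a)) :=
        (Commute.isNilpotent_mul_right (Commute.all _ _) (hx.pow_succ k)).neg
      obtain ⟨c, -, hc⟩ := exists_exp_eq_one_add_add hb
      refine ⟨x * z + -(x ^ (k + 1) * a), ⟨z - x ^ k * a, by ring⟩, ?_⟩
      rw [IsNilpotent.exp_add_of_commute (Commute.all _ _)
        (Commute.isNilpotent_mul_right (Commute.all _ _) hx) hb, hc, sub_eq_iff_eq_add.mp ha]
      refine ⟨-a - x ^ k * a ^ 2 + (1 + x + x ^ (k + 1) * a) * (x ^ k * a ^ 2 * c), ?_⟩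
      ring
  obtain ⟨d, hd⟩ := hx
  obtain ⟨y, ⟨z, rfl⟩, a, ha⟩ := key d
  refine ⟨x * z, ⟨d, by rw [mul_pow, hd, zero_mul]⟩, ?_⟩
  rw [pow_succ, hd, zero_mul, zero_mul] at ha
  exact sub_eq_zero.mp ha

lemma exists_exp_eq {x : A} (hx : IsNilpotent (x - 1)) :
    ∃ y, IsNilpotent y ∧ IsNilpotent.exp y = x := by
  set N : Algebra.adjoin ℚ {x - 1} := ⟨x - 1, Algebra.self_mem_adjoin_singleton ℚ _⟩ with hN
  have hNn : IsNilpotent N := by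
    obtain ⟨k, hk⟩ := hx
    exact ⟨k, Subtype.ext hk⟩
  obtain ⟨y, hy, he⟩ := exists_exp_eq_of_commRing hNn
  refine ⟨y, hy.map (Algebra.adjoin ℚ {x - 1}).val, ?_⟩
  have := IsNilpotent.map_exp hy (Algebra.adjoin ℚ {x - 1}).val
  rw [he] at this
  simpa [hN] using this.symm

end NilpotentExp

section Tangent

variable {ι : Type} [Fintype ι] [DecidableEq ι]

/-- The polynomials in the matrix entries vanishing on a group of matrices. -/
noncomputable def vanishingSpace (Γ : Subgroup (GL ι K)) : Submodule K (MvPolynomial (ι × ι) K) where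
  carrier := {p | ∀ A ∈ Γ, matEval (A : Matrix ι ι K) p = 0}
  add_mem' hp hq A hA := by rw [map_add, hp A hA, hq A hA, add_zero]
  zero_mem' A _ := map_zero _
  smul_mem' c p hp A hA := by rw [map_smul, hp A hA, smul_zero]

/-- A group of matrices is entry-closed if it is cut out by polynomials in the matrix entries. -/
def IsEntryClosed (Γ : Subgroup (GL ι K)) : Prop :=
  ∀ A : GL ι K, (∀ p ∈ vanishingSpace Γ, matEval (A : Matrix ι ι K) p = 0) → A ∈ Γ

/-- The Lie algebra of a group of matrices. -/
noncomputable def tangentAlg (Γ : Subgroup (GL ι K)) : Submodule K (Matrix ι ι K) where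
  carrier := {x | ∀ p ∈ vanishingSpace Γ, rightDer x p ∈ vanishingSpace Γ}
  add_mem' hx hy p hp := by
    rw [rightDer_add]
    exact add_mem (hx p hp) (hy p hp)
  zero_mem' p _ := by
    have : rightDer (0 : Matrix ι ι K) = 0 := by simpa using rightDer_smul (0 : K) (0 : Matrix ι ι K)
    rw [this]
    exact zero_mem _
  smul_mem' c x hx p hp := by
    rw [rightDer_smul]
    exact Submodule.smul_mem _ c (hx p hp)

variable {Γ : Subgroup (GL ι K)}

lemma mul_sub_mul_mem_tangentAlg {x y : Matrix ι ι K} (hx : x ∈ tangentAlg Γ)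
    (hy : y ∈ tangentAlg Γ) : x * y - y * x ∈ tangentAlg Γ := by
  intro p hp
  rw [rightDer_lie, Derivation.commutator_apply]
  exact sub_mem (hx _ (hy p hp)) (hy _ (hx p hp))

lemma rightTrans_mem_vanishingSpace {A : GL ι K} (hA : A ∈ Γ) {p : MvPolynomial (ι × ι) K}
    (hp : p ∈ vanishingSpace Γ) : rightTrans (A : Matrix ι ι K) p ∈ vanishingSpace Γ := by
  intro B hB
  rw [matEval_rightTrans, ← Units.val_mul]
  exact hp _ (mul_mem hB hA)

lemma IsEntryClosed.mem_of_stable (hΓ : IsEntryClosed Γ) {A : GL ι K}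
    (h : ∀ p ∈ vanishingSpace Γ, rightTrans (A : Matrix ι ι K) p ∈ vanishingSpace Γ) : A ∈ Γ := by
  refine hΓ A fun p hp => ?_
  simpa [matEval_rightTrans] using h p hp 1 (one_mem _)

lemma conj_mem_tangentAlg {A : GL ι K} (hA : A ∈ Γ) {x : Matrix ι ι K} (hx : x ∈ tangentAlg Γ) :
    (A : Matrix ι ι K) * x * (A⁻¹ : GL ι K) ∈ tangentAlg Γ := by
  intro p hp
  have h : (A : Matrix ι ι K) * x = (A : Matrix ι ι K) * x * (A⁻¹ : GL ι K) * A := by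
    simp [mul_assoc]
  have := rightTrans_rightDer h (rightTrans ((A⁻¹ : GL ι K) : Matrix ι ι K) p)
  rw [rightTrans_rightTrans, ← Units.val_mul, mul_inv_cancel, Units.val_one, rightTrans_one] at this
  rw [← this]
  exact rightTrans_mem_vanishingSpace hA (hx _ (rightTrans_mem_vanishingSpace (inv_mem hA) hp))

lemma pow_add_apply_of_commute {W : Type*} [AddCommGroup W] [Module K W] {a b : Module.End K W}
    (hab : Commute a b) {z : W} (hz : a z = 0) (k : ℕ) : ((a + b) ^ k) z = (b ^ k) z := by
  induction k with
  | zero => simp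
  | succ k ih =>
    rw [pow_succ', Module.End.mul_apply, ih, LinearMap.add_apply, ← Module.End.mul_apply a,
      (hab.pow_right k).eq, Module.End.mul_apply, hz, map_zero, zero_add, pow_succ',
      Module.End.mul_apply]

/-- The diagonalizable matrix with eigenbasis given by `g` and eigenvalues `a`. -/
noncomputable def conjDiag (g : GL ι K) (a : ι → K) : Matrix ι ι K :=
  (g : Matrix ι ι K) * diagonal a * (g⁻¹ : GL ι K)

lemma conjDiag_mul_self (g : GL ι K) (a : ι → K) :
    conjDiag g a * (g : Matrix ι ι K) = g * diagonal a := by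
  simp [conjDiag, mul_assoc]

lemma rightDer_conjDiag (g : GL ι K) (a : ι → K) (m : ι × ι →₀ ℕ) :
    rightDer (conjDiag g a) (rightTrans (g : Matrix ι ι K) (monomial m 1)) =
      (m.sum fun q k => (k : K) * a q.2) • rightTrans (g : Matrix ι ι K) (monomial m 1) := by
  rw [← rightTrans_rightDer (conjDiag_mul_self g a).symm, rightDer_diagonal_monomial, map_smul]

lemma rightTrans_conjDiag (g : GL ι K) (a : ι → K) (m : ι × ι →₀ ℕ) :
    rightTrans (conjDiag g a) (rightTrans (g : Matrix ι ι K) (monomial m 1)) =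
      (m.prod fun q k => a q.2 ^ k) • rightTrans (g : Matrix ι ι K) (monomial m 1) := by
  rw [rightTrans_rightTrans, conjDiag_mul_self, ← rightTrans_rightTrans,
    rightTrans_diagonal_monomial, map_smul]

lemma stable_of_jordan {g : GL ι K} {a : ι → K} {n : Matrix ι ι K} (hn : IsNilpotent n)
    (hc : Commute (conjDiag g a) n) (hx : conjDiag g a + n ∈ tangentAlg Γ)
    (Y : Module.End K (MvPolynomial (ι × ι) K)) (c : (ι × ι →₀ ℕ) → K)
    (hY : ∀ m, Y (rightTrans (g : Matrix ι ι K) (monomial m 1)) =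
      c m • rightTrans (g : Matrix ι ι K) (monomial m 1))
    (hwc : ∀ m m' : ι × ι →₀ ℕ, (m.sum fun q k => (k : K) * a q.2) =
      (m'.sum fun q k => (k : K) * a q.2) → c m = c m') :
    ∀ p ∈ vanishingSpace Γ, Y p ∈ vanishingSpace Γ := by
  refine stable_of_weights (g : Matrix ι ι K) g.isUnit _ (rightDer (conjDiag g a + n) : _ →ₗ[K] _)
    Y (fun m => m.sum fun q k => (k : K) * a q.2) c (fun m => ?_) hY hwc hx
  set μ := m.sum fun q k => (k : K) * a q.2 with hμ
  set z := rightTrans (g : Matrix ι ι K) (monomial m 1) with hz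
  obtain ⟨k, hk⟩ := rightDer_locally_nilpotent hn z
  refine ⟨k, ?_⟩
  have h1 : ((rightDer (conjDiag g a + n) : _ →ₗ[K] _) : Module.End K (MvPolynomial (ι × ι) K)) -
      algebraMap K (Module.End K (MvPolynomial (ι × ι) K)) μ =
      (((rightDer (conjDiag g a) : _ →ₗ[K] _) : Module.End K (MvPolynomial (ι × ι) K)) -
      algebraMap K (Module.End K (MvPolynomial (ι × ι) K)) μ) + (rightDer n : _ →ₗ[K] _) := by
    rw [rightDer_add, Derivation.coe_add_linearMap]
    abel
  rw [h1, pow_add_apply_of_commute _ _ k, hk]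
  · refine Commute.sub_left ?_ (Algebra.commute_algebraMap_left _ _)
    exact LinearMap.ext fun p => rightDer_comm hc p
  · simp [hz, rightDer_conjDiag, hμ]

/-- Replicas of the semisimple part of an element of the Lie algebra. -/
lemma conjDiag_mem_tangentAlg {g : GL ι K} {a b : ι → K} {n : Matrix ι ι K} (hn : IsNilpotent n)
    (hc : Commute (conjDiag g a) n) (hx : conjDiag g a + n ∈ tangentAlg Γ)
    (hab : ∀ m m' : ι × ι →₀ ℕ, (m.sum fun q k => (k : K) * a q.2) =
      (m'.sum fun q k => (k : K) * a q.2) →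
      (m.sum fun q k => (k : K) * b q.2) = (m'.sum fun q k => (k : K) * b q.2)) :
    conjDiag g b ∈ tangentAlg Γ := fun p hp =>
  stable_of_jordan hn hc hx (rightDer (conjDiag g b) : _ →ₗ[K] _) _ (rightDer_conjDiag g b) hab p hp

lemma conjDiag_mem_of_tangentAlg (hΓ : IsEntryClosed Γ) {g : GL ι K} {a b : ι → K}
    {n : Matrix ι ι K} (hn : IsNilpotent n)
    (hc : Commute (conjDiag g a) n) (hx : conjDiag g a + n ∈ tangentAlg Γ)
    (hab : ∀ m m' : ι × ι →₀ ℕ, (m.sum fun q k => (k : K) * a q.2) =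
      (m'.sum fun q k => (k : K) * a q.2) →
      (m.prod fun q k => b q.2 ^ k) = (m'.prod fun q k => b q.2 ^ k))
    {B : GL ι K} (hB : (B : Matrix ι ι K) = conjDiag g b) : B ∈ Γ := by
  refine hΓ.mem_of_stable ?_
  rw [hB]
  exact stable_of_jordan hn hc hx (rightTrans (conjDiag g b)).toLinearMap _
    (rightTrans_conjDiag g b) hab

/-- The semisimple factor of an element of a closed group belongs to the group. -/
lemma semisimple_factor_mem (hΓ : IsEntryClosed Γ) {g : GL ι K} {a : ι → K} {S W : GL ι K}
    (hS : (S : Matrix ι ι K) = conjDiag g a) (hW : IsNilpotent ((W : Matrix ι ι K) - 1))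
    (hSW : Commute S W) (h : S * W ∈ Γ) : S ∈ Γ := by
  refine hΓ.mem_of_stable ?_
  rw [hS]
  refine stable_of_weights (g : Matrix ι ι K) g.isUnit _
    (rightTrans ((S * W : GL ι K) : Matrix ι ι K)).toLinearMap
    (rightTrans (conjDiag g a)).toLinearMap (fun m => m.prod fun q k => a q.2 ^ k) _ (fun m => ?_)
    (rightTrans_conjDiag g a) (fun _ _ h => h) (fun p hp => rightTrans_mem_vanishingSpace h hp)
  set μ := m.prod fun q k => a q.2 ^ k with hμ
  set z := rightTrans (g : Matrix ι ι K) (monomial m 1) with hz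
  obtain ⟨k, hk⟩ := rightTrans_sub_one_locally_nilpotent hW z
  refine ⟨k, ?_⟩
  set s : Module.End K (MvPolynomial (ι × ι) K) := (rightTrans (S : Matrix ι ι K)).toLinearMap with hs
  set w : Module.End K (MvPolynomial (ι × ι) K) := (rightTrans (W : Matrix ι ι K)).toLinearMap with hw
  have hsw : Commute s w := LinearMap.ext fun p => by
    simp only [hs, hw, Module.End.mul_apply, AlgHom.toLinearMap_apply, rightTrans_rightTrans,
      ← Units.val_mul, hSW.eq]
  have h1 : (rightTrans ((S * W : GL ι K) : Matrix ι ι K)).toLinearMap = s * w :=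
    LinearMap.ext fun p => by
      simp only [hs, hw, Module.End.mul_apply, AlgHom.toLinearMap_apply, rightTrans_rightTrans,
        Units.val_mul]
  have hμc : ∀ f : Module.End K (MvPolynomial (ι × ι) K), Commute (algebraMap K (Module.End K _) μ) f := fun f =>
    Algebra.commute_algebraMap_left _ _
  have h2 : s * w - algebraMap K (Module.End K _) μ =
      (s - algebraMap K (Module.End K _) μ) * w + algebraMap K (Module.End K _) μ * (w - 1) := by
    rw [sub_mul, mul_sub, mul_one]
    abel
  have hsz : (s - algebraMap K (Module.End K (MvPolynomial (ι × ι) K)) μ) z = 0 := by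
    simp [hs, hS, hz, rightTrans_conjDiag, hμ]
  have hcw : Commute (s - algebraMap K (Module.End K _) μ) w := hsw.sub_left (hμc w)
  rw [h1, h2, pow_add_apply_of_commute, (hμc _).mul_pow, Module.End.mul_apply, hk, map_zero]
  · refine Commute.mul_right ((hμc _).symm) (Commute.sub_right ?_ (Commute.one_right _))
    exact hcw.mul_left (Commute.refl w)
  · rw [hcw.eq, Module.End.mul_apply, hsz, map_zero]

end Tangent

section Exponential

variable {ι : Type} [Fintype ι] [DecidableEq ι]

/-- The matrix of polynomials `t ↦ ∑ k < d, (t n) ^ k / k!`. -/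
noncomputable def expCurve (d : ℕ) (n : Matrix ι ι K) : Matrix ι ι (Polynomial K) :=
  ∑ k ∈ Finset.range d,
    (Polynomial.X ^ k : Polynomial K) • (((k.factorial : K)⁻¹ • n ^ k).map Polynomial.C)

/-- Evaluation of a polynomial in the matrix entries along the curve `t ↦ A * exp (t n)`. -/
noncomputable def alongCurve (A : Matrix ι ι K) (d : ℕ) (n : Matrix ι ι K) :
    MvPolynomial (ι × ι) K →ₐ[K] Polynomial K :=
  aeval fun q => (A.map Polynomial.C * expCurve d n) q.1 q.2

lemma eval_expCurve [CharZero K] {d : ℕ} {n : Matrix ι ι K} (hd : n ^ d = 0) (c : K) :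
    (expCurve d n).map (Polynomial.eval c) = IsNilpotent.exp (c • n) := by
  rw [IsNilpotent.exp_eq_sum (k := d) (by rw [smul_pow, hd, smul_zero])]
  ext i j
  simp only [expCurve, Matrix.map_apply, Matrix.sum_apply, Matrix.smul_apply, smul_eq_mul,
    Polynomial.eval_finsetSum, Polynomial.eval_mul, Polynomial.eval_pow, Polynomial.eval_X,
    Polynomial.eval_C, smul_pow, Rat.smul_def]
  refine Finset.sum_congr rfl fun k _ => ?_
  push_cast
  ring

lemma eval_alongCurve [CharZero K] (A : Matrix ι ι K) {d : ℕ} {n : Matrix ι ι K} (hd : n ^ d = 0)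
    (c : K) (p : MvPolynomial (ι × ι) K) :
    (alongCurve A d n p).eval c = matEval (A * IsNilpotent.exp (c • n)) p := by
  have : (Polynomial.aeval c).comp (alongCurve A d n) = matEval (A * IsNilpotent.exp (c • n)) := by
    apply MvPolynomial.algHom_ext
    rintro ⟨i, j⟩
    rw [← eval_expCurve hd]
    simp [alongCurve, Matrix.mul_apply, Polynomial.eval_finsetSum]
  simpa using DFunLike.congr_fun this p

lemma derivative_expCurve [CharZero K] {d : ℕ} {n : Matrix ι ι K} (hd : n ^ d = 0) :
    (expCurve d n).map Polynomial.derivative = expCurve d n * n.map Polynomial.C := by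
  have hL : (expCurve (d + 1) n).map Polynomial.derivative = expCurve d n * n.map Polynomial.C := by
    have h1 : (expCurve (d + 1) n).map Polynomial.derivative = ∑ k ∈ Finset.range (d + 1),
        ((k : Polynomial K) * Polynomial.X ^ (k - 1)) •
          (((k.factorial : K)⁻¹ • n ^ k).map Polynomial.C) := by
      ext1 i j
      simp [expCurve, Matrix.sum_apply, Polynomial.derivative_mul, Polynomial.derivative_X_pow]
    rw [h1, Finset.sum_range_succ', expCurve, Finset.sum_mul]
    simp only [Nat.cast_zero, zero_mul, zero_smul, add_zero, Nat.add_sub_cancel]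
    refine Finset.sum_congr rfl fun k _ => ?_
    rw [Matrix.smul_mul, ← Matrix.map_mul (f := (Polynomial.C : K →+* Polynomial K)),
      Matrix.smul_mul, ← pow_succ]
    ext1 i j
    have hk : ((k : K) + 1) ≠ 0 := by exact_mod_cast k.succ_ne_zero
    simp only [Matrix.smul_apply, Matrix.map_apply, smul_eq_mul, Nat.factorial_succ, Nat.cast_mul,
      Nat.cast_succ, mul_inv, map_mul]
    have h2 : ((k : Polynomial K) + 1) * Polynomial.C ((k : K) + 1)⁻¹ = 1 := by
      rw [show ((k : Polynomial K) + 1) = Polynomial.C ((k : K) + 1) by simp, ← Polynomial.C_mul,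
        mul_inv_cancel₀ hk, Polynomial.C_1]
    linear_combination (Polynomial.X ^ k * Polynomial.C ((k.factorial : K)⁻¹) *
      Polynomial.C ((n ^ (k + 1)) i j)) * h2
  rw [← hL, expCurve, expCurve, Finset.sum_range_succ, hd]
  simp

lemma derivative_alongCurve [CharZero K] (A : Matrix ι ι K) {d : ℕ} {n : Matrix ι ι K}
    (hd : n ^ d = 0) (p : MvPolynomial (ι × ι) K) :
    Polynomial.derivative (alongCurve A d n p) = alongCurve A d n (rightDer n p) := by
  have hC : ∀ c, alongCurve A d n (C c) = Polynomial.C c := fun c => by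
    simp [alongCurve]
  have hX : ∀ q, alongCurve A d n (X q) = (A.map Polynomial.C * expCurve d n) q.1 q.2 := fun q => by
    simp [alongCurve]
  induction p using MvPolynomial.induction_on with
  | C a => simp [hC]
  | add p q hp hq => simp [hp, hq]
  | mul_X p q hp =>
    have h : Polynomial.derivative (alongCurve A d n (X q)) =
        alongCurve A d n (rightDer n (X q)) := by
      have h1 : Polynomial.derivative (alongCurve A d n (X q)) =
          (A.map Polynomial.C * (expCurve d n).map Polynomial.derivative) q.1 q.2 := by
        simp [hX, Matrix.mul_apply, Polynomial.derivative_mul]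
      rw [h1, derivative_expCurve hd, ← mul_assoc, Matrix.mul_apply, rightDer_X, map_sum]
      simp [hX, hC]
    simp only [Derivation.leibniz, map_mul, map_add, smul_eq_mul, Polynomial.derivative_mul, h, hp]
    ring

variable {Γ : Subgroup (GL ι K)}

lemma exp_mem_of_mem_tangentAlg [CharZero K] (hΓ : IsEntryClosed Γ) {n : Matrix ι ι K}
    (hn : IsNilpotent n) (hx : n ∈ tangentAlg Γ) {B : GL ι K}
    (hB : (B : Matrix ι ι K) = IsNilpotent.exp n) : B ∈ Γ := by
  obtain ⟨d, hd⟩ := hn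
  refine hΓ B fun p hp => ?_
  have hev : ∀ q ∈ vanishingSpace Γ, (alongCurve 1 d n q).eval 0 = 0 := by
    intro q hq
    rw [eval_alongCurve 1 hd, zero_smul, IsNilpotent.exp_zero, mul_one]
    exact hq 1 (one_mem _)
  have hder : ∀ k, ∀ q ∈ vanishingSpace Γ,
      ((Polynomial.derivative^[k]) (alongCurve 1 d n q)).eval 0 = 0 := by
    intro k
    induction k with
    | zero => exact hev
    | succ k ih =>
      intro q hq
      rw [Function.iterate_succ_apply, derivative_alongCurve 1 hd]
      exact ih _ (hx q hq)
  have h0 : alongCurve 1 d n p = 0 := by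
    ext k
    have := hder k p hp
    rw [← Polynomial.coeff_zero_eq_eval_zero, Polynomial.coeff_iterate_derivative] at this
    simpa [Nat.descFactorial_self, Nat.factorial_ne_zero] using this
  have := eval_alongCurve 1 hd 1 p
  rw [h0, one_smul, one_mul, ← hB, Polynomial.eval_zero] at this
  exact this.symm

lemma alongCurve_eq_zero [CharZero K] {n : Matrix ι ι K} {d : ℕ} (hd : n ^ d = 0) {B : GL ι K}
    (hB : (B : Matrix ι ι K) = IsNilpotent.exp n) (hBΓ : B ∈ Γ) {p : MvPolynomial (ι × ι) K}
    (hp : p ∈ vanishingSpace Γ) {A : GL ι K} (hA : A ∈ Γ) :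
    alongCurve (A : Matrix ι ι K) d n p = 0 := by
  have hpow : ∀ k : ℕ, IsNilpotent.exp ((k : K) • n) = ((B ^ k : GL ι K) : Matrix ι ι K) := by
    intro k
    induction k with
    | zero => simp [IsNilpotent.exp_zero]
    | succ k ih =>
      rw [pow_succ, Units.val_mul, ← ih, hB, Nat.cast_succ, add_smul, one_smul,
        IsNilpotent.exp_add_of_commute ((Commute.refl n).smul_left _)
          ⟨d, by rw [smul_pow, hd, smul_zero]⟩ ⟨d, hd⟩]
  refine Polynomial.eq_zero_of_infinite_isRoot _ (Set.Infinite.mono ?_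
    (Set.infinite_range_of_injective (Nat.cast_injective (R := K))))
  rintro _ ⟨k, rfl⟩
  rw [Set.mem_ofPred_eq, Polynomial.IsRoot.def, eval_alongCurve _ hd, hpow, ← Units.val_mul]
  exact hp _ (mul_mem hA (pow_mem hBΓ k))

lemma mem_tangentAlg_of_exp_mem [CharZero K] {n : Matrix ι ι K} (hn : IsNilpotent n) {B : GL ι K}
    (hB : (B : Matrix ι ι K) = IsNilpotent.exp n) (hBΓ : B ∈ Γ) : n ∈ tangentAlg Γ := by
  obtain ⟨d, hd⟩ := hn
  intro p hp A hA
  have h := derivative_alongCurve (A : Matrix ι ι K) hd p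
  rw [alongCurve_eq_zero hd hB hBΓ hp hA, map_zero] at h
  have h' := eval_alongCurve (A : Matrix ι ι K) hd 0 (rightDer n p)
  rw [← h, zero_smul, IsNilpotent.exp_zero, mul_one, Polynomial.eval_zero] at h'
  exact h'.symm

end Exponential

section Closed

variable {n : ℕ}

lemma matEval_det_X {ι : Type} [Fintype ι] [DecidableEq ι] (A : Matrix ι ι K) :
    matEval A (Matrix.det (Matrix.of fun i j => X (i, j))) = A.det := by
  rw [AlgHom.map_det]
  congr 1
  ext i j
  simp

lemma matEval_adjugate_X {ι : Type} [Fintype ι] [DecidableEq ι] (A : Matrix ι ι K) (i j : ι) :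
    matEval A ((Matrix.adjugate (Matrix.of fun i j => X (i, j))) i j) = A.adjugate i j := by
  have h := congrFun (congrFun (AlgHom.map_adjugate (matEval A)
    (Matrix.of fun i j => (X (i, j) : MvPolynomial (ι × ι) K))) i) j
  rw [AlgHom.mapMatrix_apply, Matrix.map_apply] at h
  rw [h]
  congr 2
  ext i j
  simp

lemma det_mul_inv_apply (A : GL (Fin n) K) (i j : Fin n) :
    (A : Matrix (Fin n) (Fin n) K).det * ((A⁻¹ : GL (Fin n) K) : Matrix (Fin n) (Fin n) K) i j =
      (A : Matrix (Fin n) (Fin n) K).adjugate i j := by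
  have h : (A : Matrix (Fin n) (Fin n) K).adjugate =
      (A : Matrix (Fin n) (Fin n) K).det • ((A⁻¹ : GL (Fin n) K) : Matrix (Fin n) (Fin n) K) := by
    have h1 := Matrix.adjugate_mul (A : Matrix (Fin n) (Fin n) K)
    have h2 : (A : Matrix (Fin n) (Fin n) K) * ((A⁻¹ : GL (Fin n) K) : Matrix (Fin n) (Fin n) K) = 1 :=
      A.mul_inv
    rw [← mul_one (Matrix.adjugate _), ← h2, ← mul_assoc, h1, smul_mul_assoc, one_mul]
  rw [h, Matrix.smul_apply, smul_eq_mul]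

/-- Clearing denominators in a regular function on `GL n`. -/
lemma exists_matEval_eq_det_pow_mul
    (p : MvPolynomial ((Fin n × Fin n) ⊕ (Fin n × Fin n)) K) :
    ∃ (q : MvPolynomial (Fin n × Fin n) K) (d : ℕ), ∀ A : GL (Fin n) K,
      matEval (A : Matrix (Fin n) (Fin n) K) q =
        (A : Matrix (Fin n) (Fin n) K).det ^ d * eval (matOf A) p := by
  induction p using MvPolynomial.induction_on with
  | C a => exact ⟨C a, 0, fun A => by simp⟩
  | add p₁ p₂ h₁ h₂ =>
    obtain ⟨q₁, d₁, h₁⟩ := h₁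
    obtain ⟨q₂, d₂, h₂⟩ := h₂
    refine ⟨Matrix.det (Matrix.of fun i j => X (i, j)) ^ d₂ * q₁ +
      Matrix.det (Matrix.of fun i j => X (i, j)) ^ d₁ * q₂, d₁ + d₂, fun A => ?_⟩
    rw [map_add, map_mul, map_mul, map_pow, map_pow, matEval_det_X, h₁, h₂, map_add]
    ring
  | mul_X p v h =>
    obtain ⟨q, d, h⟩ := h
    rcases v with ⟨i, j⟩ | ⟨i, j⟩
    · refine ⟨q * X (i, j), d, fun A => ?_⟩
      rw [map_mul, h, map_mul]
      simp [matOf, mul_assoc]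
    · refine ⟨q * (Matrix.adjugate (Matrix.of fun i j => X (i, j))) i j, d + 1, fun A => ?_⟩
      rw [map_mul, h, map_mul, matEval_adjugate_X, ← det_mul_inv_apply]
      simp only [matOf, eval_X, Sum.elim_inr]
      ring

lemma eval_matOf_rename_inl (A : GL (Fin n) K) (q : MvPolynomial (Fin n × Fin n) K) :
    eval (matOf A) (rename Sum.inl q) = matEval (A : Matrix (Fin n) (Fin n) K) q := by
  rw [eval_rename]
  rfl

lemma isZClosed_iff {s : Set (GL (Fin n) K)} :
    IsZClosed s ↔ ∃ J : Set (MvPolynomial (Fin n × Fin n) K),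
      s = {A : GL (Fin n) K | ∀ p ∈ J, matEval (A : Matrix (Fin n) (Fin n) K) p = 0} := by
  constructor
  · rintro ⟨I, rfl⟩
    choose q d h using exists_matEval_eq_det_pow_mul (K := K) (n := n)
    refine ⟨q '' I, Set.ext fun A => ?_⟩
    have hA : (A : Matrix (Fin n) (Fin n) K).det ≠ 0 :=
      ((Matrix.isUnit_iff_isUnit_det _).1 A.isUnit).ne_zero
    simp [h, hA]
  · rintro ⟨J, rfl⟩
    refine ⟨rename Sum.inl '' J, Set.ext fun A => ?_⟩
    simp [eval_matOf_rename_inl]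

lemma IsZClosed.isEntryClosed {G : Subgroup (GL (Fin n) K)} (hG : IsZClosed (G : Set (GL (Fin n) K))) :
    IsEntryClosed G := by
  obtain ⟨J, hJ⟩ := isZClosed_iff.1 hG
  intro A hA
  have : A ∈ (G : Set (GL (Fin n) K)) := by
    rw [hJ]
    refine fun p hp => hA p fun B hB => ?_
    have : B ∈ (G : Set (GL (Fin n) K)) := hB
    rw [hJ] at this
    exact this p hp
  exact this

/-- A rational curve meeting a closed set `s`, and covered by `s` and another closed set not
containing a given point of the curve in `s`, lies in `s`. -/
lemma curve_subset {Y : Set K} (hY : Y.Infinite) (γ : K → GL (Fin n) K)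
    (hγ : ∀ q, ∃ P : Polynomial K, ∀ c ∈ Y, P.eval c = 0 ↔
      matEval (γ c : Matrix (Fin n) (Fin n) K) q = 0)
    {s t : Set (GL (Fin n) K)} (hs : IsZClosed s) (ht : IsZClosed t)
    (hst : ∀ c ∈ Y, γ c ∈ s ∪ t) {c₀ : K} (hc₀ : c₀ ∈ Y) (h₀ : γ c₀ ∉ t) {c : K} (hc : c ∈ Y) :
    γ c ∈ s := by
  obtain ⟨I, rfl⟩ := isZClosed_iff.1 hs
  obtain ⟨J, rfl⟩ := isZClosed_iff.1 ht
  intro p hp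
  by_contra hpc
  simp only [Set.mem_ofPred_eq, not_forall] at h₀
  obtain ⟨q, hq, hqc⟩ := h₀
  obtain ⟨P, hP⟩ := hγ p
  obtain ⟨Q, hQ⟩ := hγ q
  have hPQ : P * Q = 0 := by
    refine Polynomial.eq_zero_of_infinite_isRoot _ (hY.mono fun x hx => ?_)
    rw [Set.mem_ofPred_eq, Polynomial.IsRoot.def, Polynomial.eval_mul]
    rcases hst x hx with h | h
    · rw [(hP x hx).2 (h p hp), zero_mul]
    · rw [(hQ x hx).2 (h q hq), mul_zero]
  rcases mul_eq_zero.1 hPQ with h | h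
  · exact hpc ((hP c hc).1 (by simp [h]))
  · exact hqc ((hQ c₀ hc₀).1 (by simp [h]))

/-- A curve with Laurent polynomial entries depends rationally on its parameter. -/
lemma laurent_curve {ι : Type} [Fintype ι] [DecidableEq ι] (A : Matrix ι ι K) (g : GL ι K)
    (b : ι → ℤ) (q : MvPolynomial (ι × ι) K) :
    ∃ P : Polynomial K, ∀ c ∈ {c : K | c ≠ 0}, P.eval c = 0 ↔
      matEval (A * conjDiag g fun j => c ^ b j) q = 0 := by
  obtain ⟨N, hN⟩ : ∃ N : ℕ, ∀ j, 0 ≤ b j + N := by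
    refine ⟨∑ j, (b j).natAbs, fun j => ?_⟩
    have : (b j).natAbs ≤ ∑ j, (b j).natAbs := Finset.single_le_sum (f := fun j => (b j).natAbs) (fun _ _ => Nat.zero_le _)
      (Finset.mem_univ j)
    omega
  suffices h : ∃ (P : Polynomial K) (d : ℕ), ∀ c : K, c ≠ 0 →
      P.eval c = c ^ d * matEval (A * conjDiag g fun j => c ^ b j) q by
    obtain ⟨P, d, h⟩ := h
    refine ⟨P, fun c hc => ?_⟩
    rw [h c hc, mul_eq_zero, or_iff_right (pow_ne_zero _ hc)]
  induction q using MvPolynomial.induction_on with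
  | C a => exact ⟨Polynomial.C a, 0, fun c _ => by simp⟩
  | add p₁ p₂ h₁ h₂ =>
    obtain ⟨q₁, d₁, h₁⟩ := h₁
    obtain ⟨q₂, d₂, h₂⟩ := h₂
    refine ⟨Polynomial.X ^ d₂ * q₁ + Polynomial.X ^ d₁ * q₂, d₁ + d₂, fun c hc => ?_⟩
    simp only [Polynomial.eval_add, Polynomial.eval_mul, Polynomial.eval_pow, Polynomial.eval_X,
      h₁ c hc, h₂ c hc, map_add]
    ring
  | mul_X p v h =>
    obtain ⟨q, d, h⟩ := h
    obtain ⟨i, j⟩ := v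
    refine ⟨q * ∑ k, Polynomial.C ((A * (g : Matrix ι ι K)) i k *
      ((g⁻¹ : GL ι K) : Matrix ι ι K) k j) * Polynomial.X ^ (b k + N).toNat, d + N, fun c hc => ?_⟩
    rw [Polynomial.eval_mul, h c hc, map_mul, matEval_X, conjDiag, ← mul_assoc, ← mul_assoc,
      Matrix.mul_apply, Polynomial.eval_finsetSum, pow_add]
    have hk : ∀ k, Polynomial.eval c (Polynomial.C ((A * (g : Matrix ι ι K)) i k *
      ((g⁻¹ : GL ι K) : Matrix ι ι K) k j) * Polynomial.X ^ (b k + N).toNat) =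
      c ^ N * ((A * (g : Matrix ι ι K) * diagonal fun j => c ^ b j) i k *
        ((g⁻¹ : GL ι K) : Matrix ι ι K) k j) := fun k => by
      rw [Matrix.mul_diagonal]
      simp only [Polynomial.eval_mul, Polynomial.eval_C, Polynomial.eval_pow, Polynomial.eval_X]
      rw [← zpow_natCast c (b k + N).toNat, Int.toNat_of_nonneg (hN k), zpow_add₀ hc, zpow_natCast]
      ring
    rw [Finset.sum_congr rfl fun k _ => hk k, ← Finset.mul_sum]
    ring

end Closed

section Diagonalization

variable {ι : Type} [Fintype ι] [DecidableEq ι]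

lemma conjDiag_mul (g : GL ι K) (a b : ι → K) :
    conjDiag g a * conjDiag g b = conjDiag g (fun j => a j * b j) := by
  simp only [conjDiag, ← diagonal_mul_diagonal, mul_assoc, Units.inv_mul_cancel_left]

lemma conjDiag_one (g : GL ι K) : conjDiag g (fun _ => 1) = 1 := by
  rw [conjDiag, diagonal_one, mul_one]
  exact g.mul_inv

lemma conjDiag_add (g : GL ι K) (a b : ι → K) :
    conjDiag g a + conjDiag g b = conjDiag g (fun j => a j + b j) := by
  rw [conjDiag, conjDiag, conjDiag, ← diagonal_add, mul_add, add_mul]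

lemma conjDiag_smul (g : GL ι K) (c : K) (a : ι → K) :
    c • conjDiag g a = conjDiag g (fun j => c * a j) := by
  have : (fun j => c * a j) = c • a := rfl
  rw [conjDiag, conjDiag, this, diagonal_smul, mul_smul_comm, smul_mul_assoc]

lemma conjDiag_zero (g : GL ι K) : conjDiag g (fun _ => 0) = 0 := by
  simp [conjDiag]

lemma conjDiag_commute (g : GL ι K) (a b : ι → K) : Commute (conjDiag g a) (conjDiag g b) := by
  rw [Commute, SemiconjBy, conjDiag_mul, conjDiag_mul]
  simp only [mul_comm]

lemma exists_unit_eq_conjDiag (g : GL ι K) {a : ι → K} (ha : ∀ j, a j ≠ 0) :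
    ∃ B : GL ι K, (B : Matrix ι ι K) = conjDiag g a := by
  refine ⟨⟨conjDiag g a, conjDiag g fun j => (a j)⁻¹, ?_, ?_⟩, rfl⟩ <;>
  · rw [conjDiag_mul, ← conjDiag_one g]
    congr 1
    ext j
    simp [ha j]

lemma ne_zero_of_isUnit_conjDiag {g : GL ι K} {a : ι → K} (h : IsUnit (conjDiag g a)) (j : ι) :
    a j ≠ 0 := by
  have h1 := (Matrix.isUnit_iff_isUnit_det _).1 h
  have h2 : (conjDiag g a).det = ∏ j, a j := by
    rw [conjDiag, det_mul_right_comm, ← Units.val_mul, mul_inv_cancel, Units.val_one, one_mul,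
      det_diagonal]
  rw [h2] at h1
  exact (Finset.prod_ne_zero_iff.1 h1.ne_zero) j (Finset.mem_univ j)

lemma trace_mul_conjDiag_self (g : GL ι K) (a b : ι → K) :
    (conjDiag g a * conjDiag g b).trace = ∑ j, a j * b j := by
  rw [conjDiag_mul, conjDiag, Matrix.trace_mul_cycle, ← Units.val_mul, inv_mul_cancel,
    Units.val_one, one_mul, trace_diagonal]

lemma conjDiag_mulVec (g : GL ι K) (a : ι → K) (j : ι) :
    conjDiag g a *ᵥ ((g : Matrix ι ι K).col j) = a j • (g : Matrix ι ι K).col j := by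
  ext i
  have := congrFun (congrFun (conjDiag_mul_self g a) i) j
  rw [Matrix.mul_diagonal, Matrix.mul_apply] at this
  simpa [Matrix.mulVec, dotProduct, Matrix.col_apply, mul_comm] using this

lemma conjDiag_commute_iff (g : GL ι K) (a : ι → K) (x : Matrix ι ι K) :
    Commute (conjDiag g a) x ↔ ∀ i j, ((g⁻¹ : GL ι K) * x * (g : Matrix ι ι K)) i j ≠ 0 → a i = a j := by
  set y := ((g⁻¹ : GL ι K) : Matrix ι ι K) * x * (g : Matrix ι ι K) with hy
  have h1 : Commute (conjDiag g a) x ↔ diagonal a * y = y * diagonal a := by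
    have e₁ : diagonal a * y = ((g⁻¹ : GL ι K) : Matrix ι ι K) * (conjDiag g a * x) * g := by
      simp only [conjDiag, hy, mul_assoc, Units.inv_mul_cancel_left]
    have e₂ : y * diagonal a = ((g⁻¹ : GL ι K) : Matrix ι ι K) * (x * conjDiag g a) * g := by
      simp only [conjDiag, hy, mul_assoc, Units.inv_mul, mul_one]
    rw [e₁, e₂, Units.mul_left_inj, Units.mul_right_inj]
    rfl
  rw [h1, ← Matrix.ext_iff]
  refine forall_congr' fun i => forall_congr' fun j => ?_
  rw [Matrix.diagonal_mul, Matrix.mul_diagonal, mul_comm (y i j), mul_eq_mul_right_iff]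
  tauto

/-- Matrices with a spanning family of common eigenvectors are simultaneously diagonalizable. -/
lemma exists_conjDiag_of_span {σ : Type*} (f : σ → Matrix ι ι K)
    (h : Submodule.span K {v : ι → K | ∀ s, ∃ μ : K, f s *ᵥ v = μ • v} = ⊤) :
    ∃ g : GL ι K, ∀ s, ∃ a, f s = conjDiag g a := by
  set b₀ := Module.Basis.ofSpan h.ge with hb₀
  have hfin : Fintype ((linearIndepOn_empty K id).extend
      (Set.empty_subset {v : ι → K | ∀ s, ∃ μ : K, f s *ᵥ v = μ • v})) :=
    FiniteDimensional.fintypeBasisIndex b₀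
  have hcard := Module.finrank_eq_card_basis b₀
  rw [Module.finrank_fintype_fun_eq_card] at hcard
  let b := b₀.reindex (Fintype.equivOfCardEq hcard.symm)
  have hb : ∀ j s, ∃ μ : K, f s *ᵥ b j = μ • b j := fun j s => by
    have : b j ∈ Set.range b₀ := by simp [b]
    exact Module.Basis.ofSpan_subset h.ge this s
  choose a ha using hb
  let g : GL ι K := ⟨(Pi.basisFun K ι).toMatrix b, b.toMatrix (Pi.basisFun K ι),
    Module.Basis.toMatrix_mul_toMatrix_flip _ _, Module.Basis.toMatrix_mul_toMatrix_flip _ _⟩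
  refine ⟨g, fun s => ⟨fun j => a j s, ?_⟩⟩
  have hg : f s * (g : Matrix ι ι K) = g * diagonal (fun j => a j s) := by
    ext i j
    rw [Matrix.mul_diagonal]
    have := congrFun (ha j s) i
    simpa [g, Matrix.mul_apply, Matrix.mulVec, dotProduct, Module.Basis.toMatrix_apply, mul_comm] using this
  rw [conjDiag, ← hg, mul_assoc, Units.mul_inv, mul_one]

lemma mem_eigenspace_of_mem_maxGenEigenspace_conjDiag (g : GL ι K) (a : ι → K) {μ : K} {v : ι → K}
    (h : v ∈ Module.End.maxGenEigenspace (Matrix.toLin' (conjDiag g a)) μ) : conjDiag g a *ᵥ v = μ • v := by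
  rw [Module.End.mem_maxGenEigenspace] at h
  obtain ⟨k, hk⟩ := h
  have h1 : Matrix.toLin' (conjDiag g a) - μ • 1 = Matrix.toLin' (conjDiag g fun j => a j - μ) := by
    have : conjDiag g (fun j => a j - μ) = conjDiag g a - μ • 1 := by
      rw [← conjDiag_one g, conjDiag_smul, eq_sub_iff_add_eq, conjDiag_add]
      simp
    rw [this]
    simp [Module.End.one_eq_id]
  have h2 : ∀ k, (conjDiag g fun j => a j - μ) ^ k = conjDiag g fun j => (a j - μ) ^ k := fun k => by
    induction k with
    | zero => simp [conjDiag_one]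
    | succ k ih => simp only [pow_succ, ih, conjDiag_mul]
  rw [h1, ← Matrix.toLin'_pow, h2, Matrix.toLin'_apply] at hk
  have h3 : ∀ b : ι → K, conjDiag g b *ᵥ v = 0 ↔ ∀ j, b j * (((g⁻¹ : GL ι K) : Matrix ι ι K) *ᵥ v) j = 0 := fun b => by
    rw [conjDiag, mul_assoc, ← Matrix.mulVec_mulVec, ← Matrix.mulVec_mulVec]
    constructor
    · intro h j
      have := congrArg (fun w => ((g⁻¹ : GL ι K) : Matrix ι ι K) *ᵥ w) h
      simp only [Matrix.mulVec_mulVec, Matrix.mulVec_zero] at this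
      rw [← mul_assoc, ← Units.val_mul, inv_mul_cancel, Units.val_one, one_mul,
        ← Matrix.mulVec_mulVec] at this
      simpa [Matrix.mulVec_diagonal] using congrFun this j
    · intro h
      have : diagonal b *ᵥ ((g⁻¹ : GL ι K) : Matrix ι ι K) *ᵥ v = 0 := by
        ext j
        simpa [Matrix.mulVec_diagonal] using h j
      rw [this, Matrix.mulVec_zero]
  have h4 : conjDiag g (fun j => a j - μ) *ᵥ v = 0 := by
    rw [h3]
    intro j
    have := (h3 _).1 hk j
    rcases mul_eq_zero.1 this with h | h
    · rw [eq_zero_of_pow_eq_zero h, zero_mul]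
    · rw [h, mul_zero]
  have : conjDiag g a = conjDiag g (fun j => a j - μ) + μ • 1 := by
      rw [← conjDiag_one g, conjDiag_smul, conjDiag_add]
      simp
  rw [this, Matrix.add_mulVec, h4, zero_add, Matrix.smul_mulVec, Matrix.one_mulVec]

lemma span_eigenvectors_conjDiag (g : GL ι K) (a : ι → K) {p : Submodule K (ι → K)}
    (hp : ∀ v, (∃ μ : K, conjDiag g a *ᵥ v = μ • v) → v ∈ p) : p = ⊤ := by
  have hcol : ∀ j, (g : Matrix ι ι K).col j ∈ p := fun j => hp _ ⟨a j, conjDiag_mulVec g a j⟩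
  refine eq_top_iff.2 fun v _ => ?_
  have : v = ∑ j, (((g⁻¹ : GL ι K) : Matrix ι ι K) *ᵥ v) j • (g : Matrix ι ι K).col j := by
    have h : v = (g : Matrix ι ι K) *ᵥ ((g⁻¹ : GL ι K) : Matrix ι ι K) *ᵥ v := by
      rw [Matrix.mulVec_mulVec, ← Units.val_mul, mul_inv_cancel, Units.val_one, Matrix.one_mulVec]
    conv_lhs => rw [h]
    ext i
    simp [Matrix.mulVec, dotProduct, mul_comm]
  rw [this]
  exact sum_mem fun j _ => p.smul_mem _ (hcol j)

/-- Commuting diagonalizable matrices are simultaneously diagonalizable. -/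
lemma exists_conjDiag_of_commute {σ : Type*} (f : σ → Matrix ι ι K)
    (hc : ∀ s t, Commute (f s) (f t)) (hd : ∀ s, ∃ g a, f s = conjDiag g a) :
    ∃ g : GL ι K, ∀ s, ∃ a, f s = conjDiag g a := by
  refine exists_conjDiag_of_span f (eq_top_iff.2 ?_)
  rw [← Module.End.iSup_iInf_maxGenEigenspace_eq_top_of_iSup_maxGenEigenspace_eq_top_of_commute
    (fun s => Matrix.toLin' (f s)) (fun s t _ => ?_) (fun s => ?_)]
  · refine iSup_le fun χ v hv => Submodule.subset_span fun s => ⟨χ s, ?_⟩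
    obtain ⟨g, a, h⟩ := hd s
    have := (Submodule.mem_iInf _).1 hv s
    rw [h] at this ⊢
    exact mem_eigenspace_of_mem_maxGenEigenspace_conjDiag g a this
  · exact (hc s t).map (Matrix.toLinAlgEquiv' (R := K) (n := ι))
  · obtain ⟨g, a, h⟩ := hd s
    refine span_eigenvectors_conjDiag g a fun v ⟨μ, hv⟩ => ?_
    refine Submodule.mem_iSup_of_mem μ ?_
    rw [Module.End.mem_maxGenEigenspace]
    exact ⟨1, by simp [h, hv]⟩

/-- The additive Jordan decomposition of a matrix. -/
lemma exists_jordan [IsAlgClosed K] (x : Matrix ι ι K) :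
    ∃ (g : GL ι K) (a : ι → K) (n : Matrix ι ι K), x = conjDiag g a + n ∧ IsNilpotent n ∧
      Commute (conjDiag g a) n ∧ ∀ y, Commute y x → Commute y (conjDiag g a) := by
  obtain ⟨n, hn, s, hs, hnil, hss, hx⟩ :=
    Module.End.exists_isNilpotent_isSemisimple (f := Matrix.toLinAlgEquiv' x)
  have hcomm : ∀ y, Commute y (Matrix.toLinAlgEquiv' x) →
      ∀ z ∈ Algebra.adjoin K {Matrix.toLinAlgEquiv' x}, Commute y z := fun y hy z hz => by
    have : Algebra.adjoin K {Matrix.toLinAlgEquiv' x} ≤ Subalgebra.centralizer K {y} :=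
      Algebra.adjoin_le (by
        rintro _ rfl
        rw [SetLike.mem_coe, Subalgebra.mem_centralizer_iff]
        rintro _ rfl
        exact hy.eq)
    exact (Subalgebra.mem_centralizer_iff K).1 (this hz) y rfl
  have hsn : Commute s n := (hcomm s ((hcomm _ (Commute.refl _) s hs).symm) n hn)
  obtain ⟨g, hg⟩ := exists_conjDiag_of_span (fun _ : Unit => Matrix.toLinAlgEquiv'.symm s) (by
    rw [eq_top_iff, ← Module.End.iSup_maxGenEigenspace_eq_top s]
    refine iSup_le fun μ v hv => Submodule.subset_span fun _ => ⟨μ, ?_⟩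
    rw [hss.isFinitelySemisimple.maxGenEigenspace_eq_eigenspace,
      Module.End.mem_eigenspace_iff] at hv
    rw [← hv, ← Matrix.toLinAlgEquiv'_apply, AlgEquiv.apply_symm_apply])
  obtain ⟨a, ha⟩ := hg ()
  refine ⟨g, a, Matrix.toLinAlgEquiv'.symm n, ?_, hnil.map _, ?_, fun y hy => ?_⟩
  · rw [← ha, ← map_add, add_comm, ← hx, AlgEquiv.symm_apply_apply]
  · rw [← ha]
    exact hsn.map _
  · have := (hcomm (Matrix.toLinAlgEquiv' y) (hy.map _) s hs).map (Matrix.toLinAlgEquiv' (R := K) (n := ι)).symm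
    rwa [AlgEquiv.symm_apply_apply, ha] at this

end Diagonalization

section Replicas

variable {ι : Type} [Fintype ι] [DecidableEq ι]

/-- Finitely many elements of a field of characteristic zero have integral coordinates with
respect to a `ℤ`-linearly independent family. -/
lemma exists_int_coords [CharZero K] (a : ι → K) :
    ∃ (r : ℕ) (e : Fin r → K) (b : Fin r → ι → ℤ), LinearIndependent ℤ e ∧
      ∀ j, a j = ∑ i, (b i j : K) * e i := by
  set N := Submodule.span ℤ (Set.range a) with hN
  have : Module.Finite ℤ N := Module.Finite.span_of_finite ℤ (Set.finite_range a)
  have : Module.Free ℤ N := Module.free_of_finite_type_torsion_free'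
  let B := Module.finBasis ℤ N
  refine ⟨_, fun i => (B i : K), fun i j => B.repr ⟨a j, Submodule.subset_span ⟨j, rfl⟩⟩ i,
    B.linearIndependent.map' N.subtype N.ker_subtype, fun j => ?_⟩
  have := congrArg N.subtype (B.sum_repr ⟨a j, Submodule.subset_span ⟨j, rfl⟩⟩)
  rw [map_sum] at this
  simpa using this.symm

lemma sum_weight_int {r : ℕ} {e : Fin r → K} {b : Fin r → ι → ℤ} {a : ι → K}
    (ha : ∀ j, a j = ∑ i, (b i j : K) * e i) (m : ι × ι →₀ ℕ) :
    (m.sum fun q k => (k : K) * a q.2) = ∑ i, (m.sum fun q k => (k : ℤ) * b i q.2) • e i := by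
  simp only [Finsupp.sum, ha, Finset.mul_sum, Finset.sum_smul, zsmul_eq_mul]
  rw [Finset.sum_comm]
  refine Finset.sum_congr rfl fun i _ => Finset.sum_congr rfl fun q _ => ?_
  push_cast
  ring

lemma weight_int_eq {r : ℕ} {e : Fin r → K} {b : Fin r → ι → ℤ} {a : ι → K}
    (he : LinearIndependent ℤ e) (ha : ∀ j, a j = ∑ i, (b i j : K) * e i) {m m' : ι × ι →₀ ℕ}
    (h : (m.sum fun q k => (k : K) * a q.2) = (m'.sum fun q k => (k : K) * a q.2)) (i : Fin r) :
    (m.sum fun q k => (k : ℤ) * b i q.2) = (m'.sum fun q k => (k : ℤ) * b i q.2) := by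
  rw [sum_weight_int ha, sum_weight_int ha] at h
  exact Fintype.linearIndependent_iffₛ.1 he _ _ h i

lemma eq_zero_of_sum_mul_int_eq_zero [CharZero K] {r : ℕ} {e : Fin r → K} {b : Fin r → ι → ℤ}
    {a : ι → K} (he : LinearIndependent ℤ e) (ha : ∀ j, a j = ∑ i, (b i j : K) * e i)
    (h : ∀ i, ∑ j, a j * (b i j : K) = 0) : a = 0 := by
  have hb : ∀ i j, b i j = 0 := by
    intro i
    have h1 : ∑ k, (∑ j, b k j * b i j) • e k = 0 := by
      rw [← h i]
      simp only [ha, Finset.sum_mul, Finset.sum_smul]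
      rw [Finset.sum_comm]
      refine Finset.sum_congr rfl fun j _ => Finset.sum_congr rfl fun k _ => ?_
      rw [zsmul_eq_mul]
      push_cast
      ring
    have h2 := Fintype.linearIndependent_iff.1 he _ h1 i
    rw [Finset.sum_eq_zero_iff_of_nonneg fun j _ => mul_self_nonneg _] at h2
    exact fun j => mul_self_eq_zero.1 (h2 j (Finset.mem_univ j))
  ext j
  simp [ha, hb]

variable {Γ : Subgroup (GL ι K)} {g : GL ι K} {a : ι → K} {n : Matrix ι ι K}
  {r : ℕ} {e : Fin r → K} {b : Fin r → ι → ℤ}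

lemma conjDiag_int_mem_tangentAlg (he : LinearIndependent ℤ e)
    (ha : ∀ j, a j = ∑ i, (b i j : K) * e i) (hn : IsNilpotent n)
    (hc : Commute (conjDiag g a) n) (hx : conjDiag g a + n ∈ tangentAlg Γ) (i : Fin r) :
    conjDiag g (fun j => (b i j : K)) ∈ tangentAlg Γ := by
  refine conjDiag_mem_tangentAlg hn hc hx fun m m' h => ?_
  have := congrArg (fun z : ℤ => (z : K)) (weight_int_eq he ha h i)
  simpa [Finsupp.sum] using this

lemma prod_zpow_weight {c : K} (hc : c ≠ 0) (b : ι → ℤ) (m : ι × ι →₀ ℕ) :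
    (m.prod fun q k => (c ^ b q.2) ^ k) = c ^ (m.sum fun q k => (k : ℤ) * b q.2) := by
  rw [Finsupp.prod, Finsupp.sum]
  induction m.support using Finset.induction_on with
  | empty => simp
  | insert q s hq ih =>
    rw [Finset.prod_insert hq, Finset.sum_insert hq, ih, zpow_add₀ hc, mul_comm (m q : ℤ),
      _root_.zpow_mul, zpow_natCast]

lemma conjDiag_zpow_mem (hΓ : IsEntryClosed Γ) (he : LinearIndependent ℤ e)
    (ha : ∀ j, a j = ∑ i, (b i j : K) * e i) (hn : IsNilpotent n)
    (hc : Commute (conjDiag g a) n) (hx : conjDiag g a + n ∈ tangentAlg Γ) (i : Fin r)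
    {c : K} (hc₀ : c ≠ 0) {B : GL ι K} (hB : (B : Matrix ι ι K) = conjDiag g fun j => c ^ b i j) :
    B ∈ Γ := by
  refine conjDiag_mem_of_tangentAlg hΓ hn hc hx (fun m m' h => ?_) hB
  rw [prod_zpow_weight hc₀, prod_zpow_weight hc₀, weight_int_eq he ha h i]

end Replicas

section Torus

variable {n : ℕ}

/-- The Zariski closure of a group of matrices. -/
noncomputable def closureSG (S : Subgroup (GL (Fin n) K)) : Subgroup (GL (Fin n) K) where
  carrier := {A | ∀ p ∈ vanishingSpace S, rightTrans (A : Matrix (Fin n) (Fin n) K) p ∈ vanishingSpace S ∧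
    rightTrans ((A⁻¹ : GL (Fin n) K) : Matrix (Fin n) (Fin n) K) p ∈ vanishingSpace S}
  mul_mem' := by
    intro A B hA hB p hp
    rw [_root_.mul_inv_rev, Units.val_mul, Units.val_mul, ← rightTrans_rightTrans,
      ← rightTrans_rightTrans]
    exact ⟨(hA _ (hB p hp).1).1, (hB _ (hA p hp).2).2⟩
  one_mem' := by
    intro p hp
    simpa [rightTrans_one] using hp
  inv_mem' := by
    intro A hA p hp
    rw [inv_inv]
    exact (hA p hp).symm

variable {S : Subgroup (GL (Fin n) K)}

lemma le_closureSG : S ≤ closureSG S := fun _ hA _ hp =>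
  ⟨rightTrans_mem_vanishingSpace hA hp, rightTrans_mem_vanishingSpace (inv_mem hA) hp⟩

lemma closureSG_subset {s : Set (GL (Fin n) K)} (hs : IsZClosed s)
    (hS : (S : Set (GL (Fin n) K)) ⊆ s) : (closureSG S : Set (GL (Fin n) K)) ⊆ s := by
  obtain ⟨J, rfl⟩ := isZClosed_iff.1 hs
  intro A hA p hp
  have := (hA p fun B hB => hS hB p hp).1 1 (one_mem S)
  rwa [matEval_rightTrans, Units.val_one, one_mul] at this

lemma eval_matOf_mul_inl (A B : GL (Fin n) K) (p : MvPolynomial (Fin n × Fin n) K) :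
    eval (matOf A) (bind₁ (fun q => ∑ k, C ((B : Matrix (Fin n) (Fin n) K) q.1 k) *
      X (Sum.inl (k, q.2))) p) = matEval ((B : Matrix (Fin n) (Fin n) K) * (A : Matrix (Fin n) (Fin n) K)) p := by
  rw [← coe_aeval_eq_eval, RingHom.coe_coe, aeval_bind₁]
  simp [matEval, matOf, Matrix.mul_apply, aeval_def]

lemma eval_matOf_mul_inr (A B : GL (Fin n) K) (p : MvPolynomial (Fin n × Fin n) K) :
    eval (matOf A) (bind₁ (fun q => ∑ k, C ((B : Matrix (Fin n) (Fin n) K) q.1 k) *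
      X (Sum.inr (k, q.2))) p) =
      matEval ((B : Matrix (Fin n) (Fin n) K) * ((A⁻¹ : GL (Fin n) K) : Matrix (Fin n) (Fin n) K)) p := by
  rw [← coe_aeval_eq_eval, RingHom.coe_coe, aeval_bind₁]
  simp [matEval, matOf, Matrix.mul_apply, aeval_def]

lemma isZClosed_closureSG : IsZClosed (closureSG S : Set (GL (Fin n) K)) := by
  refine ⟨{P | ∃ p ∈ vanishingSpace S, ∃ B ∈ S,
    P = bind₁ (fun q => ∑ k, C ((B : Matrix (Fin n) (Fin n) K) q.1 k) * X (Sum.inl (k, q.2))) p ∨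
    P = bind₁ (fun q => ∑ k, C ((B : Matrix (Fin n) (Fin n) K) q.1 k) * X (Sum.inr (k, q.2))) p},
    Set.ext fun A => ⟨?_, ?_⟩⟩
  · rintro hA P ⟨p, hp, B, hB, rfl | rfl⟩
    · rw [eval_matOf_mul_inl, ← matEval_rightTrans]
      exact (hA p hp).1 B hB
    · rw [eval_matOf_mul_inr, ← matEval_rightTrans]
      exact (hA p hp).2 B hB
  · intro hA p hp
    refine ⟨fun B hB => ?_, fun B hB => ?_⟩
    · rw [matEval_rightTrans, ← eval_matOf_mul_inl]
      exact hA _ ⟨p, hp, B, hB, Or.inl rfl⟩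
    · rw [matEval_rightTrans, ← eval_matOf_mul_inr]
      exact hA _ ⟨p, hp, B, hB, Or.inr rfl⟩

lemma isZClosed_conjDiag (g : GL (Fin n) K) :
    IsZClosed {A : GL (Fin n) K | ∃ a, (A : Matrix (Fin n) (Fin n) K) = conjDiag g a} := by
  have key : ∀ A : GL (Fin n) K, (∃ a, (A : Matrix (Fin n) (Fin n) K) = conjDiag g a) ↔
      ∀ i j, i ≠ j → (((g⁻¹ : GL (Fin n) K) : Matrix (Fin n) (Fin n) K) * A * g) i j = 0 := by
    intro A
    constructor
    · rintro ⟨a, ha⟩ i j hij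
      rw [ha, mul_assoc, conjDiag_mul_self, Units.inv_mul_cancel_left, diagonal_apply_ne _ hij]
    · intro h
      refine ⟨fun i => (((g⁻¹ : GL (Fin n) K) : Matrix (Fin n) (Fin n) K) * A * g) i i, ?_⟩
      have : diagonal (fun i => (((g⁻¹ : GL (Fin n) K) : Matrix (Fin n) (Fin n) K) * A * g) i i) =
          ((g⁻¹ : GL (Fin n) K) : Matrix (Fin n) (Fin n) K) * A * g := by
        ext i j
        rcases eq_or_ne i j with rfl | hij
        · simp
        · rw [diagonal_apply_ne _ hij, h i j hij]
      rw [conjDiag, this]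
      simp only [mul_assoc, Units.mul_inv, mul_one, Units.mul_inv_cancel_left]
  refine isZClosed_iff.2 ⟨{p | ∃ i j, i ≠ j ∧ p = ∑ k, ∑ l,
    C (((g⁻¹ : GL (Fin n) K) : Matrix (Fin n) (Fin n) K) i l * (g : Matrix (Fin n) (Fin n) K) k j) *
      X (l, k)}, Set.ext fun A => ?_⟩
  rw [Set.mem_ofPred_eq, key]
  have hP : ∀ i j, matEval (A : Matrix (Fin n) (Fin n) K) (∑ k, ∑ l,
    C (((g⁻¹ : GL (Fin n) K) : Matrix (Fin n) (Fin n) K) i l * (g : Matrix (Fin n) (Fin n) K) k j) *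
      X (l, k)) = (((g⁻¹ : GL (Fin n) K) : Matrix (Fin n) (Fin n) K) * A * g) i j := fun i j => by
    simp only [map_sum, map_mul, matEval_X, Matrix.mul_apply, Finset.sum_mul, matEval_C]
    exact Finset.sum_congr rfl fun k _ => Finset.sum_congr rfl fun l _ => by ring
  constructor
  · rintro h p ⟨i, j, hij, rfl⟩
    rw [hP, h i j hij]
  · intro h i j hij
    rw [← hP]
    exact h _ ⟨i, j, hij, rfl⟩

lemma exists_diag_closure_iff [IsAlgClosed K] {T : Subgroup (GL (Fin n) K)} :
    (∃ g : GL (Fin n) (AlgebraicClosure K), ∀ A ∈ T, Matrix.IsDiag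
      ((g * glBaseChange A * g⁻¹ : GL (Fin n) (AlgebraicClosure K)) :
        Matrix (Fin n) (Fin n) (AlgebraicClosure K))) ↔
    ∃ g : GL (Fin n) K, ∀ A ∈ T, ∃ a, (A : Matrix (Fin n) (Fin n) K) = conjDiag g a := by
  have hinj : Function.Injective (algebraMap K (AlgebraicClosure K)) := RingHom.injective _
  have hg : ∀ g A : GL (Fin n) K, Matrix.IsDiag ((glBaseChange g * glBaseChange A * (glBaseChange g)⁻¹ :
      GL (Fin n) (AlgebraicClosure K)) : Matrix (Fin n) (Fin n) (AlgebraicClosure K)) ↔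
      Matrix.IsDiag ((g * A * g⁻¹ : GL (Fin n) K) : Matrix (Fin n) (Fin n) K) := fun g A => by
    rw [← map_mul, ← map_inv, ← map_mul]
    refine ⟨fun h i j hij => hinj ?_, fun h i j hij => ?_⟩
    · rw [map_zero]
      exact h hij
    · have := congrArg (algebraMap K (AlgebraicClosure K)) (h hij)
      rwa [map_zero] at this
  constructor
  · rintro ⟨g, h⟩
    let σ : K ≃+* AlgebraicClosure K := RingEquiv.ofBijective (algebraMap K (AlgebraicClosure K))
      (IsAlgClosed.algebraMap_bijective_of_isIntegral)
    let g' : GL (Fin n) K := Units.map (σ.symm.toRingHom.mapMatrix.toMonoidHom) g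
    have hg' : glBaseChange g' = g := by
      ext i j
      exact σ.apply_symm_apply _
    refine ⟨g'⁻¹, fun A hA => ?_⟩
    have h1 := h A hA
    rw [← hg', hg] at h1
    refine ⟨fun i => ((g' * A * g'⁻¹ : GL (Fin n) K) : Matrix (Fin n) (Fin n) K) i i, ?_⟩
    have h2 : diagonal (fun i => ((g' * A * g'⁻¹ : GL (Fin n) K) : Matrix (Fin n) (Fin n) K) i i) = 
      ((g' * A * g'⁻¹ : GL (Fin n) K) : Matrix (Fin n) (Fin n) K) := h1.diagonal_diag
    rw [conjDiag, h2, ← Units.val_mul, ← Units.val_mul]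
    congr 1
    group
  · rintro ⟨g, h⟩
    refine ⟨glBaseChange g⁻¹, fun A hA => ?_⟩
    rw [hg]
    obtain ⟨a, ha⟩ := h A hA
    rw [Units.val_mul, Units.val_mul, ha, inv_inv, mul_assoc, conjDiag_mul_self,
      Units.inv_mul_cancel_left]
    exact isDiag_diagonal a

end Torus

section MaximalTorus

variable {n : ℕ} [IsAlgClosed K] {G T : Subgroup (GL (Fin n) K)}

lemma IsTorus.exists_conjDiag (hT : IsTorus T) :
    ∃ g : GL (Fin n) K, ∀ A ∈ T, ∃ a, (A : Matrix (Fin n) (Fin n) K) = conjDiag g a :=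
  exists_diag_closure_iff.1 hT.2.2

/-- A one-parameter subgroup of `G` centralizing a maximal torus lies in the torus. -/
lemma IsMaximalTorus.conjDiag_zpow_mem (hG : IsZClosed (G : Set (GL (Fin n) K)))
    (hT : IsMaximalTorus G T) {g : GL (Fin n) K} {b : Fin n → ℤ}
    (hb : ∀ c : K, c ≠ 0 → ∀ B : GL (Fin n) K,
      (B : Matrix (Fin n) (Fin n) K) = conjDiag g (fun j => c ^ b j) → B ∈ G)
    (hbT : ∀ c : K, c ≠ 0 → ∀ t ∈ T,
      Commute (t : Matrix (Fin n) (Fin n) K) (conjDiag g (fun j => c ^ b j)))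
    {c : K} (hc : c ≠ 0) {B : GL (Fin n) K}
    (hB : (B : Matrix (Fin n) (Fin n) K) = conjDiag g (fun j => c ^ b j)) : B ∈ T := by
  obtain ⟨⟨hTcl, hTconn, hTdiag⟩, hTG, hmax⟩ := hT
  obtain ⟨g₀, hg₀⟩ := exists_diag_closure_iff.1 hTdiag
  have hmul : ∀ c c' : K, conjDiag g (fun j => c ^ b j) * conjDiag g (fun j => c' ^ b j) =
      conjDiag g (fun j => (c * c') ^ b j) := fun c c' => by
    simp only [conjDiag_mul, mul_zpow]
  let S : Subgroup (GL (Fin n) K) :=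
    { carrier := {A | ∃ t ∈ T, ∃ c : K, c ≠ 0 ∧ (A : Matrix (Fin n) (Fin n) K) =
        (t : Matrix (Fin n) (Fin n) K) * conjDiag g (fun j => c ^ b j)}
      mul_mem' := by
        rintro A A' ⟨t, ht, c, hc, hA⟩ ⟨t', ht', c', hc', hA'⟩
        refine ⟨t * t', mul_mem ht ht', c * c', mul_ne_zero hc hc', ?_⟩
        rw [Units.val_mul, Units.val_mul, hA, hA', ← hmul, mul_assoc, ← mul_assoc (conjDiag _ _),
          ← (hbT c hc t' ht').eq]
        simp only [mul_assoc]
      one_mem' := ⟨1, one_mem T, 1, one_ne_zero, by simp [conjDiag_one]⟩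
      inv_mem' := by
        rintro A ⟨t, ht, c, hc, hA⟩
        refine ⟨t⁻¹, inv_mem ht, c⁻¹, inv_ne_zero hc, ?_⟩
        have h : (A : Matrix (Fin n) (Fin n) K) * (((t⁻¹ : GL (Fin n) K) : Matrix (Fin n) (Fin n) K) *
            conjDiag g (fun j => c⁻¹ ^ b j)) = 1 := by
          rw [hA, (hbT c hc t ht).eq, mul_assoc, ← mul_assoc (t : Matrix (Fin n) (Fin n) K),
            Units.mul_inv, one_mul, hmul, mul_inv_cancel₀ hc]
          simp [conjDiag_one]
        rw [← Units.inv_mul_cancel_left A (_ * _), h, mul_one] }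
  have hTS : T ≤ S := fun t ht => ⟨t, ht, 1, one_ne_zero, by simp [conjDiag_one]⟩
  have hSG : S ≤ G := by
    rintro A ⟨t, ht, c, hc, hA⟩
    obtain ⟨B, hB⟩ := exists_unit_eq_conjDiag g (a := fun j => c ^ b j) fun j => zpow_ne_zero _ hc
    have : A = t * B := Units.ext (by rw [hA, Units.val_mul, hB])
    rw [this]
    exact mul_mem (hTG ht) (hb c hc B hB)
  obtain ⟨g₁, hg₁⟩ := exists_conjDiag_of_commute
    (Sum.elim (fun t : T => ((t : GL (Fin n) K) : Matrix (Fin n) (Fin n) K))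
      (fun c : Kˣ => conjDiag g (fun j => (c : K) ^ b j))) (by
    rintro (⟨t, ht⟩ | c) (⟨t', ht'⟩ | c')
    · obtain ⟨a, ha⟩ := hg₀ t ht
      obtain ⟨a', ha'⟩ := hg₀ t' ht'
      simp only [Sum.elim_inl, ha, ha']
      exact conjDiag_commute _ _ _
    · exact hbT _ c'.ne_zero t ht
    · exact (hbT _ c.ne_zero t' ht').symm
    · exact conjDiag_commute _ _ _) (by
    rintro (⟨t, ht⟩ | c)
    · exact ⟨g₀, hg₀ t ht⟩
    · exact ⟨g, _, rfl⟩)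
  have hSdiag : (S : Set (GL (Fin n) K)) ⊆ {A | ∃ a, (A : Matrix (Fin n) (Fin n) K) = conjDiag g₁ a} := by
    rintro A ⟨t, ht, c, hc, hA⟩
    obtain ⟨a, ha⟩ := hg₁ (Sum.inl ⟨t, ht⟩)
    obtain ⟨a', ha'⟩ := hg₁ (Sum.inr (Units.mk0 c hc))
    simp only [Sum.elim_inl, Sum.elim_inr, Units.val_mk0] at ha ha'
    exact ⟨_, by rw [hA, ha, ha', conjDiag_mul]⟩
  have hconn : ∀ s t : Set (GL (Fin n) K), IsZClosed s → IsZClosed t →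
      (closureSG S : Set (GL (Fin n) K)) ⊆ s ∪ t → (closureSG S : Set (GL (Fin n) K)) ∩ s ∩ t = ∅ →
      (T : Set (GL (Fin n) K)) ⊆ s → (closureSG S : Set (GL (Fin n) K)) ⊆ s := by
    intro s t hs ht hst hdisj hTs
    refine closureSG_subset hs ?_
    rintro A ⟨u, hu, c, hc, hA⟩
    choose γ hγ using fun c : {c : K // c ≠ 0} => exists_unit_eq_conjDiag g (a := fun j => c.1 ^ b j)
      fun j => zpow_ne_zero _ c.2
    let δ : K → GL (Fin n) K := fun c => open Classical in if h : c ≠ 0 then u * γ ⟨c, h⟩ else 1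
    have hδ : ∀ c ≠ 0, (δ c : Matrix (Fin n) (Fin n) K) =
        (u : Matrix (Fin n) (Fin n) K) * conjDiag g (fun j => c ^ b j) := fun c hc => by
      simp only [δ, dif_pos hc, Units.val_mul, hγ]
    have hδS : ∀ c ≠ 0, δ c ∈ S := fun c hc => ⟨u, hu, c, hc, hδ c hc⟩
    have hδ1 : δ 1 = u := Units.ext (by rw [hδ 1 one_ne_zero]; simp [conjDiag_one])
    have hδc : A = δ c := Units.ext (by rw [hA, hδ c hc])
    rw [hδc]
    refine curve_subset (Y := {c : K | c ≠ 0}) (Set.finite_singleton (0 : K)).infinite_compl δ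
      (fun q => ?_) hs ht (fun c hc => hst (le_closureSG (hδS c hc))) (c₀ := 1) one_ne_zero ?_ hc
    · obtain ⟨P, hP⟩ := laurent_curve (u : Matrix (Fin n) (Fin n) K) g b q
      exact ⟨P, fun c hc => by rw [hP c hc, hδ c hc]⟩
    · intro h1
      rw [hδ1] at h1
      have : u ∈ (closureSG S : Set (GL (Fin n) K)) ∩ s ∩ t :=
        ⟨⟨le_closureSG (hTS hu), hTs hu⟩, h1⟩
      rw [hdisj] at this
      exact this
  have hSbar : IsTorus (closureSG S) := by
    refine ⟨isZClosed_closureSG, fun s t hs ht hst hdisj => ?_, exists_diag_closure_iff.2 ⟨g₁,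
      fun A hA => closureSG_subset (isZClosed_conjDiag g₁) hSdiag hA⟩⟩
    have hTc : (T : Set (GL (Fin n) K)) ⊆ closureSG S := fun t ht => le_closureSG (hTS ht)
    rcases hTconn s t hs ht (hTc.trans hst) (Set.subset_eq_empty (by gcongr) hdisj) with h | h
    · exact Or.inl (hconn s t hs ht hst hdisj h)
    · refine Or.inr (hconn t s ht hs (by rwa [Set.union_comm]) ?_ h)
      rwa [Set.inter_right_comm]
  rw [← hmax _ hSbar (closureSG_subset hG hSG) (hTS.trans le_closureSG)]
  exact le_closureSG ⟨1, one_mem T, c, hc, by rw [hB, Units.val_one, one_mul]⟩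

/-- The semisimple part of an element of the Lie algebra centralizing a maximal torus is central in
the centralizer of the torus. -/
lemma IsMaximalTorus.commute_conjDiag [CharZero K] (hG : IsZClosed (G : Set (GL (Fin n) K)))
    (hT : IsMaximalTorus G T) {g : GL (Fin n) K} {a : Fin n → K} {x : Matrix (Fin n) (Fin n) K}
    (hx : IsNilpotent x) (hc : Commute (conjDiag g a) x) (hmem : conjDiag g a + x ∈ tangentAlg G)
    (haT : ∀ t ∈ T, Commute (t : Matrix (Fin n) (Fin n) K) (conjDiag g a))
    {y : Matrix (Fin n) (Fin n) K} (hy : ∀ t ∈ T, Commute (t : Matrix (Fin n) (Fin n) K) y) :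
    Commute (conjDiag g a) y := by
  obtain ⟨r, e, b, he, ha⟩ := exists_int_coords a
  have hab : ∀ j k, a j = a k → ∀ i, b i j = b i k := fun j k h => by
    rw [ha, ha] at h
    simp only [← zsmul_eq_mul] at h
    exact Fintype.linearIndependent_iffₛ.1 he _ _ h
  have hB : ∀ i (B : GL (Fin n) K),
      (B : Matrix (Fin n) (Fin n) K) = conjDiag g (fun j => (2 : K) ^ b i j) → B ∈ T :=
    fun i B hB => hT.conjDiag_zpow_mem hG
      (fun c hc₀ B hB => _root_.conjDiag_zpow_mem hG.isEntryClosed he ha hx hc hmem i hc₀ hB)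
      (fun c _ t ht => by
        have := (conjDiag_commute_iff g a _).1 (haT t ht).symm
        exact ((conjDiag_commute_iff g _ _).2 fun j k hjk => by rw [hab j k (this j k hjk) i]).symm)
      two_ne_zero hB
  rw [conjDiag_commute_iff]
  intro j k hjk
  rw [ha, ha]
  refine Finset.sum_congr rfl fun i _ => ?_
  obtain ⟨B, hBi⟩ := exists_unit_eq_conjDiag g (a := fun j => (2 : K) ^ b i j)
    fun j => zpow_ne_zero _ two_ne_zero
  have h1 := hy B (hB i B hBi)
  rw [hBi, conjDiag_commute_iff] at h1
  have h2 := h1 j k hjk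
  have h3 : b i j = b i k := by
    have h4 : (((2 : ℚ) ^ b i j : ℚ) : K) = (((2 : ℚ) ^ b i k : ℚ) : K) := by
      push_cast
      exact h2
    exact zpow_right_injective₀ (by norm_num) (by norm_num) (Rat.cast_injective h4)
  rw [h3]

end MaximalTorus

section Averaging

variable {ι : Type} [Fintype ι] [DecidableEq ι]

/-- A nonempty affine family of matrices stable under conjugation by a diagonalizable group contains
a matrix fixed by conjugation. -/
lemma exists_commute_of_affine {T : Subgroup (GL ι K)} {g : GL ι K}
    (hg : ∀ t ∈ T, ∃ a, (t : Matrix ι ι K) = conjDiag g a) {S : Set (Matrix ι ι K)}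
    (hne : S.Nonempty) (haff : ∀ y ∈ S, ∀ z ∈ S, ∀ c : K, c • y + (1 - c) • z ∈ S)
    (hconj : ∀ t ∈ T, ∀ y ∈ S, (t : Matrix ι ι K) * y * ((t⁻¹ : GL ι K) : Matrix ι ι K) ∈ S) :
    ∃ y ∈ S, ∀ t ∈ T, Commute (t : Matrix ι ι K) y := by
  classical
  let coord : Matrix ι ι K → Matrix ι ι K := fun y => ((g⁻¹ : GL ι K) : Matrix ι ι K) * y * g
  let supp : Matrix ι ι K → Finset (ι × ι) := fun y => {q | coord y q.1 q.2 ≠ 0}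
  obtain ⟨y, hyS, hmin⟩ := WellFounded.has_min (measure fun y => (supp y).card).wf S hne
  refine ⟨y, hyS, fun t ht => ?_⟩
  obtain ⟨a, ha⟩ := hg t ht
  have ha0 : ∀ j, a j ≠ 0 := ne_zero_of_isUnit_conjDiag (g := g) (ha ▸ t.isUnit)
  rw [ha, conjDiag_commute_iff]
  intro i j hij
  by_contra hne
  have hc1 : a j - a i ≠ 0 := sub_ne_zero.2 (Ne.symm hne)
  set w := (t : Matrix ι ι K) * y * ((t⁻¹ : GL ι K) : Matrix ι ι K) with hw
  have hwt : w * conjDiag g a = conjDiag g a * y := by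
    rw [hw, ← ha, mul_assoc, Units.inv_mul, mul_one]
  have hcw : ∀ k l, coord w k l * a l = a k * coord y k l := fun k l => by
    have h1 : coord w * diagonal a = diagonal a * coord y := by
      have e₁ : coord w * diagonal a = ((g⁻¹ : GL ι K) : Matrix ι ι K) * (w * conjDiag g a) * g := by
        simp only [coord, conjDiag, mul_assoc, Units.inv_mul, mul_one]
      have e₂ : diagonal a * coord y = ((g⁻¹ : GL ι K) : Matrix ι ι K) * (conjDiag g a * y) * g := by
        simp only [coord, conjDiag, mul_assoc, Units.inv_mul_cancel_left]
      rw [e₁, e₂, hwt]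
    have := congrFun (congrFun h1 k) l
    rwa [Matrix.mul_diagonal, Matrix.diagonal_mul] at this
  set c := a j / (a j - a i) with hc
  set z := c • w + (1 - c) • y with hz
  have hcz : ∀ k l, coord z k l = c * coord w k l + (1 - c) * coord y k l := fun k l => by
    have : coord z = c • coord w + (1 - c) • coord y := by
      simp only [coord, hz, mul_add, add_mul, mul_smul_comm, smul_mul_assoc]
    rw [this]
    rfl
  refine hmin z (haff _ (hconj t ht y hyS) _ hyS c) (Finset.card_lt_card ?_)
  rw [Finset.ssubset_iff_of_subset]
  · refine ⟨(i, j), Finset.mem_filter.2 ⟨Finset.mem_univ _, hij⟩, ?_⟩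
    have h1 : coord z i j = 0 := by
      rw [hcz, hc]
      field_simp
      linear_combination hcw i j
    simp [supp, h1]
  · rintro ⟨k, l⟩ hkl
    simp only [supp, Finset.mem_filter, Finset.mem_univ, true_and] at hkl ⊢
    refine fun h0 => hkl ?_
    have h1 := hcw k l
    rw [h0, mul_zero, mul_eq_zero, or_iff_left (ha0 l)] at h1
    rw [hcz, h1, h0, mul_zero, mul_zero, add_zero]

end Averaging

section Flag

attribute [local instance] LieRing.ofAssociativeRing

variable {ι : Type} [Fintype ι] [DecidableEq ι]

/-- The Lie algebra of endomorphisms attached to a space of matrices closed under commutators. -/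
def matrixLieSubalgebra (r : Submodule K (Matrix ι ι K))
    (hr : ∀ x ∈ r, ∀ y ∈ r, x * y - y * x ∈ r) : LieSubalgebra K (Module.End K (ι → K)) where
  toSubmodule := r.map (Matrix.toLinAlgEquiv' (R := K) (n := ι)).toLinearMap
  lie_mem' := by
    rintro _ _ ⟨x, hx, rfl⟩ ⟨y, hy, rfl⟩
    exact ⟨x * y - y * x, hr x hx y hy, by
      rw [LieRing.of_associative_ring_bracket]
      simp⟩

/-- The descending flag of subspaces generated by a space of matrices. -/
def descFlag (r : Submodule K (Matrix ι ι K)) : ℕ → Submodule K (ι → K)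
  | 0 => ⊤
  | k + 1 => Submodule.span K {w | ∃ x ∈ r, ∃ v ∈ descFlag r k, x *ᵥ v = w}

variable {r : Submodule K (Matrix ι ι K)}

lemma mulVec_mem_descFlag {x : Matrix ι ι K} (hx : x ∈ r) {k : ℕ} {v : ι → K} (hv : v ∈ descFlag r k) :
    x *ᵥ v ∈ descFlag r (k + 1) :=
  Submodule.subset_span ⟨x, hx, v, hv, rfl⟩

lemma descFlag_succ_le (r : Submodule K (Matrix ι ι K)) (k : ℕ) :
    descFlag r (k + 1) ≤ descFlag r k := by
  induction k with
  | zero => exact le_top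
  | succ k ih =>
    refine Submodule.span_mono ?_
    rintro _ ⟨x, hx, v, hv, rfl⟩
    exact ⟨x, hx, v, ih hv, rfl⟩

/-- Engel's theorem for spaces of nilpotent matrices. -/
lemma exists_descFlag_eq_bot (hr : ∀ x ∈ r, ∀ y ∈ r, x * y - y * x ∈ r)
    (hnil : ∀ x ∈ r, IsNilpotent x) : ∃ d, descFlag r d = ⊥ := by
  let L := matrixLieSubalgebra r hr
  have hL : LieModule.IsNilpotent L (ι → K) := by
    rw [LieModule.isNilpotent_iff_forall' (R := K)]
    rintro ⟨_, x, hx, rfl⟩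
    exact (hnil x hx).map (Matrix.toLinAlgEquiv' (R := K) (n := ι))
  obtain ⟨d, hd⟩ := (LieModule.isNilpotent_iff K L (ι → K)).1 hL
  have h : ∀ k, descFlag r k ≤ (LieModule.lowerCentralSeries K L (ι → K) k).toSubmodule := by
    intro k
    induction k with
    | zero => exact le_top
    | succ k ih =>
      refine Submodule.span_le.2 ?_
      rintro _ ⟨x, hx, v, hv, rfl⟩
      rw [LieModule.lowerCentralSeries_succ]
      exact LieSubmodule.lie_mem_lie (LieSubmodule.mem_top (⟨_, x, hx, rfl⟩ : L)) (ih hv)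
  refine ⟨d, eq_bot_iff.2 ((h d).trans ?_)⟩
  rw [hd]
  rfl

lemma mulVec_mem_descFlag_of_conj {A : GL ι K}
    (hA : ∀ x ∈ r, (A : Matrix ι ι K) * x * ((A⁻¹ : GL ι K) : Matrix ι ι K) ∈ r) {k : ℕ} {v : ι → K}
    (hv : v ∈ descFlag r k) : (A : Matrix ι ι K) *ᵥ v ∈ descFlag r k := by
  induction k generalizing v with
  | zero => trivial
  | succ k ih =>
    induction hv using Submodule.span_induction with
    | mem w hw =>
      obtain ⟨x, hx, v, hv, rfl⟩ := hw
      have : (A : Matrix ι ι K) *ᵥ x *ᵥ v = ((A : Matrix ι ι K) * x *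
          ((A⁻¹ : GL ι K) : Matrix ι ι K)) *ᵥ (A : Matrix ι ι K) *ᵥ v := by
        rw [Matrix.mulVec_mulVec, Matrix.mulVec_mulVec, mul_assoc _ _ (A : Matrix ι ι K),
          Units.inv_mul, mul_one]
      rw [this]
      exact mulVec_mem_descFlag (hA x hx) (ih hv)
    | zero => rw [Matrix.mulVec_zero]; exact zero_mem _
    | add v w _ _ h₁ h₂ => rw [Matrix.mulVec_add]; exact add_mem h₁ h₂
    | smul c v _ h => rw [Matrix.mulVec_smul]; exact Submodule.smul_mem _ c h

/-- The elements of a group stabilizing the flag of a stable space of matrices and acting trivially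
on its graded pieces. -/
def flagUnipotent (G : Subgroup (GL ι K)) (r : Submodule K (Matrix ι ι K))
    (hG : ∀ A ∈ G, ∀ x ∈ r, (A : Matrix ι ι K) * x * ((A⁻¹ : GL ι K) : Matrix ι ι K) ∈ r) :
    Subgroup (GL ι K) where
  carrier := {A | A ∈ G ∧ ∀ k, ∀ v ∈ descFlag r k, (A : Matrix ι ι K) *ᵥ v - v ∈ descFlag r (k + 1)}
  mul_mem' := by
    rintro A B ⟨hA, hA'⟩ ⟨hB, hB'⟩
    refine ⟨mul_mem hA hB, fun k v hv => ?_⟩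
    rw [Units.val_mul, ← Matrix.mulVec_mulVec]
    have : (A : Matrix ι ι K) *ᵥ (B : Matrix ι ι K) *ᵥ v - v =
        (A : Matrix ι ι K) *ᵥ ((B : Matrix ι ι K) *ᵥ v - v) + ((A : Matrix ι ι K) *ᵥ v - v) := by
      rw [Matrix.mulVec_sub]
      abel
    rw [this]
    exact add_mem (mulVec_mem_descFlag_of_conj (hG A hA) (hB' k v hv)) (hA' k v hv)
  one_mem' := ⟨one_mem G, fun k v _ => by simp⟩
  inv_mem' := by
    rintro A ⟨hA, hA'⟩
    refine ⟨inv_mem hA, fun k v hv => ?_⟩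
    have : ((A⁻¹ : GL ι K) : Matrix ι ι K) *ᵥ v - v =
        -(((A⁻¹ : GL ι K) : Matrix ι ι K) *ᵥ ((A : Matrix ι ι K) *ᵥ v - v)) := by
      rw [Matrix.mulVec_sub, Matrix.mulVec_mulVec, Units.inv_mul, Matrix.one_mulVec]
      abel
    rw [this]
    exact neg_mem (mulVec_mem_descFlag_of_conj (hG _ (inv_mem hA)) (hA' k v hv))

variable {G : Subgroup (GL ι K)}

lemma conj_mem_flagUnipotent
    {hG : ∀ A ∈ G, ∀ x ∈ r, (A : Matrix ι ι K) * x * ((A⁻¹ : GL ι K) : Matrix ι ι K) ∈ r}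
    {A u : GL ι K} (hA : A ∈ G) (hu : u ∈ flagUnipotent G r hG) :
    A * u * A⁻¹ ∈ flagUnipotent G r hG := by
  refine ⟨mul_mem (mul_mem hA hu.1) (inv_mem hA), fun k v hv => ?_⟩
  have : ((A * u * A⁻¹ : GL ι K) : Matrix ι ι K) *ᵥ v - v = (A : Matrix ι ι K) *ᵥ
      ((u : Matrix ι ι K) *ᵥ ((A⁻¹ : GL ι K) : Matrix ι ι K) *ᵥ v -
        ((A⁻¹ : GL ι K) : Matrix ι ι K) *ᵥ v) := by
    rw [Matrix.mulVec_sub]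
    simp only [Matrix.mulVec_mulVec, Units.mul_inv, Matrix.one_mulVec, Units.val_mul, mul_assoc]
  rw [this]
  exact mulVec_mem_descFlag_of_conj (hG A hA)
    (hu.2 k _ (mulVec_mem_descFlag_of_conj (hG _ (inv_mem hA)) hv))

lemma isNilpotent_sub_one_of_mem_flagUnipotent
    {hG : ∀ A ∈ G, ∀ x ∈ r, (A : Matrix ι ι K) * x * ((A⁻¹ : GL ι K) : Matrix ι ι K) ∈ r}
    {d : ℕ} (hd : descFlag r d = ⊥) {u : GL ι K} (hu : u ∈ flagUnipotent G r hG) :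
    IsNilpotent ((u : Matrix ι ι K) - 1) := by
  have h : ∀ k (v : ι → K), ((u : Matrix ι ι K) - 1) ^ k *ᵥ v ∈ descFlag r k := by
    intro k v
    induction k with
    | zero => trivial
    | succ k ih =>
      rw [pow_succ', ← Matrix.mulVec_mulVec, Matrix.sub_mulVec, Matrix.one_mulVec]
      exact hu.2 k _ ih
  refine ⟨d, Matrix.ext_of_mulVec_single fun i => ?_⟩
  have := h d (Pi.single i 1)
  rw [hd, Submodule.mem_bot] at this
  rw [this, Matrix.zero_mulVec]

lemma exp_mem_flagUnipotent [CharZero K]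
    {hG : ∀ A ∈ G, ∀ x ∈ r, (A : Matrix ι ι K) * x * ((A⁻¹ : GL ι K) : Matrix ι ι K) ∈ r}
    {x : Matrix ι ι K} (hx : x ∈ r) (hn : IsNilpotent x) {A : GL ι K} (hA : A ∈ G)
    (hAx : (A : Matrix ι ι K) = IsNilpotent.exp x) : A ∈ flagUnipotent G r hG := by
  refine ⟨hA, fun k v hv => ?_⟩
  have hpow : ∀ l, x ^ l *ᵥ v ∈ descFlag r k := by
    intro l
    induction l with
    | zero => simpa using hv
    | succ l ih =>
      rw [pow_succ', ← Matrix.mulVec_mulVec]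
      exact descFlag_succ_le r k (mulVec_mem_descFlag hx ih)
  obtain ⟨d, hd⟩ := hn
  have hd' : x ^ (d + 1) = 0 := by rw [pow_succ, hd, zero_mul]
  rw [hAx, IsNilpotent.exp_eq_sum hd', Finset.sum_range_succ', Matrix.add_mulVec]
  simp only [pow_zero, Nat.factorial_zero, Nat.cast_one, inv_one, one_smul, Matrix.one_mulVec,
    add_sub_cancel_right]
  rw [Matrix.sum_mulVec]
  refine sum_mem fun l _ => ?_
  have : ((((l + 1).factorial : ℚ)⁻¹ • x ^ (l + 1)) : Matrix ι ι K) =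
      ((((l + 1).factorial : ℚ)⁻¹ : ℚ) : K) • x ^ (l + 1) := by
    ext i j
    simp [Rat.smul_def]
  rw [this, Matrix.smul_mulVec, pow_succ', ← Matrix.mulVec_mulVec]
  exact Submodule.smul_mem _ _ (mulVec_mem_descFlag hx (hpow l))

end Flag

section Radical

variable {n : ℕ}

lemma IsZClosed.iInter {α : Sort*} {s : α → Set (GL (Fin n) K)} (h : ∀ i, IsZClosed (s i)) :
    IsZClosed (⋂ i, s i) := by
  choose I hI using h
  refine ⟨⋃ i, I i, Set.ext fun A => ?_⟩
  simp only [hI, Set.mem_iInter, Set.mem_iUnion, Set.mem_ofPred_eq]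
  exact ⟨fun h p ⟨i, hi⟩ => h i p hi, fun h i p hp => h p ⟨i, hp⟩⟩

lemma IsZClosed.inter {s t : Set (GL (Fin n) K)} (hs : IsZClosed s) (ht : IsZClosed t) :
    IsZClosed (s ∩ t) := by
  rw [Set.inter_eq_iInter]
  exact IsZClosed.iInter fun b => by cases b <;> assumption

lemma isZClosed_mulVec_sub_mem (v : Fin n → K) (W : Submodule K (Fin n → K)) :
    IsZClosed {A : GL (Fin n) K | (A : Matrix (Fin n) (Fin n) K) *ᵥ v - v ∈ W} := by
  refine isZClosed_iff.2 ⟨{p | ∃ f ∈ W.dualAnnihilator, p =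
    (∑ k, ∑ l, C (f (Pi.single k 1) * v l) * X (k, l)) - C (f v)}, Set.ext fun A => ?_⟩
  have hf : ∀ f : Module.Dual K (Fin n → K), matEval (A : Matrix (Fin n) (Fin n) K)
      ((∑ k, ∑ l, C (f (Pi.single k 1) * v l) * X (k, l)) - C (f v)) =
      f ((A : Matrix (Fin n) (Fin n) K) *ᵥ v - v) := by
    intro f
    rw [map_sub, map_sub, matEval_C, f.pi_apply_eq_sum_univ (_ *ᵥ v)]
    simp only [map_sum, map_mul, matEval_X, matEval_C, Matrix.mulVec, dotProduct, smul_eq_mul,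
      Finset.sum_mul]
    congr 1
    refine Finset.sum_congr rfl fun k _ => Finset.sum_congr rfl fun l _ => ?_
    have : (Pi.single k 1 : Fin n → K) = fun j => if k = j then 1 else 0 := by
      ext j
      simp [Pi.single_apply, eq_comm]
    rw [this]
    ring
  rw [Set.mem_ofPred_eq, ← Subspace.forall_mem_dualAnnihilator_apply_eq_zero_iff]
  constructor
  · rintro h p ⟨f, hfW, rfl⟩
    rw [hf, h f hfW]
  · intro h f hfW
    rw [← hf]
    exact h _ ⟨f, hfW, rfl⟩

lemma isZClosed_flagUnipotent {G : Subgroup (GL (Fin n) K)} {r : Submodule K (Matrix (Fin n) (Fin n) K)}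
    (hG : ∀ A ∈ G, ∀ x ∈ r, (A : Matrix (Fin n) (Fin n) K) * x * ((A⁻¹ : GL (Fin n) K) : Matrix (Fin n) (Fin n) K) ∈ r)
    (hcl : IsZClosed (G : Set (GL (Fin n) K))) :
    IsZClosed (flagUnipotent G r hG : Set (GL (Fin n) K)) := by
  have h := hcl.inter (IsZClosed.iInter fun k => IsZClosed.iInter fun v : descFlag r k =>
    isZClosed_mulVec_sub_mem (v : Fin n → K) (descFlag r (k + 1)))
  convert h using 1
  ext A
  simp [flagUnipotent]

lemma exists_unit_eq_exp {ι : Type} [Fintype ι] [DecidableEq ι] [CharZero K] {x : Matrix ι ι K} (hx : IsNilpotent x) :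
    ∃ B : GL ι K, (B : Matrix ι ι K) = IsNilpotent.exp x :=
  IsNilpotent.isUnit_exp hx

/-- Closed groups of unipotent matrices in characteristic zero are connected. -/
lemma isConnectedSG_of_unipotent [CharZero K] {U : Subgroup (GL (Fin n) K)}
    (hU : IsZClosed (U : Set (GL (Fin n) K)))
    (hu : ∀ u ∈ U, IsNilpotent ((u : Matrix (Fin n) (Fin n) K) - 1)) : IsConnectedSG U := by
  intro s t hs ht hst hdisj
  have key : ∀ s t : Set (GL (Fin n) K), IsZClosed s → IsZClosed t →
      (U : Set (GL (Fin n) K)) ⊆ s ∪ t → (U : Set (GL (Fin n) K)) ∩ s ∩ t = ∅ → 1 ∈ s →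
      (U : Set (GL (Fin n) K)) ⊆ s := by
    intro s t hs ht hst hdisj h1 A hA
    obtain ⟨ν, hν, hexp⟩ := exists_exp_eq (hu A hA)
    have hmem := mem_tangentAlg_of_exp_mem hν hexp.symm hA
    have hνc : ∀ c : K, IsNilpotent (c • ν) := fun c => hν.smul c
    choose γ hγ using fun c : K => exists_unit_eq_exp (hνc c)
    obtain ⟨d, hd⟩ := hν
    have h0 : γ 0 = 1 := Units.ext (by rw [hγ, zero_smul, IsNilpotent.exp_zero, Units.val_one])
    have hA1 : γ 1 = A := Units.ext (by rw [hγ, one_smul, hexp])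
    rw [← hA1]
    refine curve_subset Set.infinite_univ γ (fun q => ⟨alongCurve 1 d ν q, fun c _ => ?_⟩) hs ht
      (fun c _ => hst ?_) (Set.mem_univ 0) (fun h => ?_) (Set.mem_univ 1)
    · rw [eval_alongCurve 1 hd, one_mul, hγ]
    · exact exp_mem_of_mem_tangentAlg hU.isEntryClosed (hνc c) (Submodule.smul_mem _ c hmem) (hγ c)
    · rw [h0] at h
      exact (hdisj.subset ⟨⟨one_mem U, h1⟩, h⟩ : _)
  rcases hst (one_mem U) with h | h
  · exact Or.inl (key s t hs ht hst hdisj h)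
  · refine Or.inr (key t s ht hs (by rwa [Set.union_comm]) ?_ h)
    rw [Set.inter_right_comm]
    exact hdisj

lemma isUnipotentElt_of_isNilpotent {u : GL (Fin n) K}
    (hu : IsNilpotent ((u : Matrix (Fin n) (Fin n) K) - 1)) : IsUnipotentElt u := by
  have h := (Matrix.isNilpotent_charpoly_sub_pow_of_isNilpotent hu).eq_zero
  rw [Fintype.card_fin, sub_eq_zero] at h
  have := Matrix.aeval_self_charpoly ((u : Matrix (Fin n) (Fin n) K) - 1)
  rwa [h, map_pow, Polynomial.aeval_X] at this

variable {G : Subgroup (GL (Fin n) K)}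

/-- The radical of the trace form on the Lie algebra of a group of matrices. -/
noncomputable def traceRadical (G : Subgroup (GL (Fin n) K)) :
    Submodule K (Matrix (Fin n) (Fin n) K) where
  carrier := {x | x ∈ tangentAlg G ∧ ∀ y ∈ tangentAlg G, (x * y).trace = 0}
  add_mem' := fun {x z} hx hz => ⟨add_mem hx.1 hz.1, fun y hy => by
    rw [add_mul, Matrix.trace_add, hx.2 y hy, hz.2 y hy, add_zero]⟩
  zero_mem' := ⟨zero_mem _, fun y _ => by simp⟩
  smul_mem' := fun c x hx => ⟨Submodule.smul_mem _ c hx.1, fun y hy => by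
    rw [smul_mul_assoc, Matrix.trace_smul, hx.2 y hy, smul_zero]⟩

lemma conj_mem_traceRadical {A : GL (Fin n) K} (hA : A ∈ G) {x : Matrix (Fin n) (Fin n) K}
    (hx : x ∈ traceRadical G) : (A : Matrix (Fin n) (Fin n) K) * x *
      ((A⁻¹ : GL (Fin n) K) : Matrix (Fin n) (Fin n) K) ∈ traceRadical G := by
  refine ⟨conj_mem_tangentAlg hA hx.1, fun y hy => ?_⟩
  have := hx.2 _ (conj_mem_tangentAlg (inv_mem hA) hy)
  rw [inv_inv] at this
  rw [← this, mul_assoc, mul_assoc, Matrix.trace_mul_comm, mul_assoc]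

lemma isNilpotent_of_mem_traceRadical [IsAlgClosed K] [CharZero K] {x : Matrix (Fin n) (Fin n) K}
    (hx : x ∈ traceRadical G) : IsNilpotent x := by
  obtain ⟨g, a, ν, rfl, hν, hc, -⟩ := exists_jordan x
  obtain ⟨r, e, b, he, ha⟩ := exists_int_coords a
  have h0 : a = 0 := by
    refine eq_zero_of_sum_mul_int_eq_zero he ha fun i => ?_
    have h1 := hx.2 _ (conjDiag_int_mem_tangentAlg he ha hν hc hx.1 i)
    have hcb : Commute (conjDiag g fun j => (b i j : K)) ν := by
      rw [conjDiag_commute_iff] at hc ⊢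
      intro j k hjk
      have hjk' := hc j k hjk
      have h2 : ∑ l, (b l j - b l k) • e l = 0 := by
        simp only [sub_smul, Finset.sum_sub_distrib, zsmul_eq_mul]
        rw [← ha, ← ha, hjk', sub_self]
      have := Fintype.linearIndependent_iff.1 he _ h2 i
      rw [sub_eq_zero.1 this]
    have h3 : (ν * conjDiag g fun j => (b i j : K)).trace = 0 :=
      (Matrix.isNilpotent_trace_of_isNilpotent (hcb.symm.isNilpotent_mul_right hν)).eq_zero
    rwa [add_mul, Matrix.trace_add, h3, add_zero, trace_mul_conjDiag_self] at h1
  subst h0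
  have : conjDiag g 0 = 0 := conjDiag_zero g
  rwa [this, zero_add]

lemma IsReductive.traceRadical_eq_bot [IsAlgClosed K] [CharZero K] (hG : IsReductive G) :
    traceRadical G = ⊥ := by
  obtain ⟨hcl, -, hrad⟩ := hG
  have hconj : ∀ A ∈ G, ∀ x ∈ traceRadical G, (A : Matrix (Fin n) (Fin n) K) * x *
      ((A⁻¹ : GL (Fin n) K) : Matrix (Fin n) (Fin n) K) ∈ traceRadical G :=
    fun A hA x hx => conj_mem_traceRadical hA hx
  obtain ⟨d, hd⟩ := exists_descFlag_eq_bot (r := traceRadical G)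
    (fun x hx y hy => ⟨mul_sub_mul_mem_tangentAlg hx.1 hy.1, fun z hz => by
      rw [← hx.2 _ (mul_sub_mul_mem_tangentAlg hy.1 hz), sub_mul, mul_sub, Matrix.trace_sub,
        Matrix.trace_sub, mul_assoc, ← mul_assoc x z y, Matrix.trace_mul_comm (x * z) y, mul_assoc]⟩)
    (fun x hx => isNilpotent_of_mem_traceRadical hx)
  have hcl' := isZClosed_flagUnipotent hconj hcl
  have hnil : ∀ u ∈ flagUnipotent G (traceRadical G) hconj,
      IsNilpotent ((u : Matrix (Fin n) (Fin n) K) - 1) :=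
    fun u hu => isNilpotent_sub_one_of_mem_flagUnipotent hd hu
  have hbot := hrad _ (fun u (hu : u ∈ flagUnipotent G (traceRadical G) hconj) => hu.1) hcl' (isConnectedSG_of_unipotent hcl' hnil)
    (fun A hA u hu => conj_mem_flagUnipotent hA hu)
    (fun u hu => isUnipotentElt_of_isNilpotent (hnil u hu))
  refine (Submodule.eq_bot_iff _).2 fun x hx => ?_
  have hxn := isNilpotent_of_mem_traceRadical hx
  obtain ⟨B, hB⟩ := exists_unit_eq_exp hxn
  have hBmem := exp_mem_flagUnipotent (hG := hconj) hx hxn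
    (exp_mem_of_mem_tangentAlg hcl.isEntryClosed hxn hx.1 hB) hB
  rw [hbot, Subgroup.mem_bot] at hBmem
  refine eq_zero_of_exp_eq_one hxn ?_
  rw [← hB, hBmem, Units.val_one]

end Radical

section Centralizer

attribute [local instance] LieRing.ofAssociativeRing

/-- If semisimple parts of the elements of a Lie algebra of matrices are central, then nilpotent
elements lie in the radical of the trace form. -/
lemma trace_mul_eq_zero_of_isNilpotent [IsAlgClosed K] [CharZero K] {ι : Type} [Fintype ι]
    [DecidableEq ι] {c : Submodule K (Matrix ι ι K)}
    (hc : ∀ x ∈ c, ∀ y ∈ c, x * y - y * x ∈ c)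
    (hs : ∀ x ∈ c, ∃ s n, x = s + n ∧ IsNilpotent n ∧ ∀ y ∈ c, Commute s y)
    {M : Matrix ι ι K} (hM : M ∈ c) (hMn : IsNilpotent M) {y : Matrix ι ι K} (hy : y ∈ c) :
    (M * y).trace = 0 := by
  let L := matrixLieSubalgebra c hc
  let e := Matrix.toLinAlgEquiv' (R := K) (n := ι)
  have hL : LieRing.IsNilpotent L := by
    rw [LieAlgebra.isNilpotent_iff_forall (R := K)]
    rintro ⟨_, x, hx, rfl⟩
    obtain ⟨s, ν, rfl, hν, hsc⟩ := hs x hx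
    obtain ⟨d, hd⟩ := LieAlgebra.ad_nilpotent_of_nilpotent (R := K) (hν.map e)
    refine ⟨d, LinearMap.ext fun z => Subtype.ext ?_⟩
    have h : ∀ k, ((((LieAlgebra.ad K L) ⟨e (s + ν), s + ν, hx, rfl⟩) ^ k) z : Module.End K (ι → K)) =
        ((LieAlgebra.ad K (Module.End K (ι → K)) (e ν)) ^ k) z := by
      intro k
      induction k with
      | zero => rfl
      | succ k ih =>
        rw [pow_succ', pow_succ', Module.End.mul_apply, Module.End.mul_apply, ← ih,
          LieAlgebra.ad_apply, LieAlgebra.ad_apply, LieSubalgebra.coe_bracket]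
        obtain ⟨w, hw, hwe⟩ := ((((LieAlgebra.ad K L) ⟨e (s + ν), s + ν, hx, rfl⟩) ^ k) z).2
        rw [← hwe]
        change ⁅e (s + ν), e w⁆ = ⁅e ν, e w⁆
        rw [map_add, add_lie, add_eq_right, LieRing.of_associative_ring_bracket, sub_eq_zero]
        exact (hsc w hw).map e
    exact (h d).trans (by rw [hd]; rfl)
  have h := LieModule.traceForm_eq_sum_finrank_nsmul_mul K L (ι → K) ⟨e M, M, hM, rfl⟩ ⟨e y, y, hy, rfl⟩
  rw [Finset.sum_eq_zero fun χ _ => ?_] at h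
  · rw [LieModule.traceForm_apply_apply] at h
    change LinearMap.trace K (ι → K) (e M * e y) = 0 at h
    rw [← map_mul] at h
    exact (Matrix.trace_toLin'_eq _).symm.trans h
  · rw [χ.apply_eq_zero_of_isNilpotent _ (hMn.map e), zero_mul, smul_zero]

end Centralizer

section MaximalTorus

variable {n : ℕ} {G T : Subgroup (GL (Fin n) K)}

/-- In the Lie algebra of a reductive group, no nonzero nilpotent element centralizes a maximal
torus. -/
lemma IsReductive.eq_zero_of_commute [IsAlgClosed K] [CharZero K] (hG : IsReductive G)
    (hT : IsMaximalTorus G T) {M : Matrix (Fin n) (Fin n) K} (hM : M ∈ tangentAlg G)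
    (hMn : IsNilpotent M) (hMT : ∀ t ∈ T, Commute (t : Matrix (Fin n) (Fin n) K) M) : M = 0 := by
  let c : Submodule K (Matrix (Fin n) (Fin n) K) :=
    { carrier := {x | x ∈ tangentAlg G ∧ ∀ t ∈ T, Commute (t : Matrix (Fin n) (Fin n) K) x}
      add_mem' := fun hx hy => ⟨add_mem hx.1 hy.1, fun t ht => (hx.2 t ht).add_right (hy.2 t ht)⟩
      zero_mem' := ⟨zero_mem _, fun t _ => Commute.zero_right _⟩
      smul_mem' := fun k x hx => ⟨Submodule.smul_mem _ k hx.1, fun t ht => (hx.2 t ht).smul_right k⟩ }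
  have hc : ∀ x ∈ c, ∀ y ∈ c, x * y - y * x ∈ c := fun x hx y hy =>
    ⟨mul_sub_mul_mem_tangentAlg hx.1 hy.1, fun t ht =>
      ((hx.2 t ht).mul_right (hy.2 t ht)).sub_right ((hy.2 t ht).mul_right (hx.2 t ht))⟩
  have hs : ∀ x ∈ c, ∃ s ν, x = s + ν ∧ IsNilpotent ν ∧ ∀ y ∈ c, Commute s y := by
    intro x hx
    obtain ⟨g, a, ν, rfl, hν, hcν, hcomm⟩ := exists_jordan x
    exact ⟨_, ν, rfl, hν, fun y hy => hT.commute_conjDiag hG.1 hν hcν hx.1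
      (fun t ht => hcomm _ (hx.2 t ht)) hy.2⟩
  obtain ⟨g, hg⟩ := hT.1.exists_conjDiag
  have hrad : M ∈ traceRadical G := by
    refine ⟨hM, fun y hy => ?_⟩
    obtain ⟨z, ⟨hz, hzM⟩, hzT⟩ := exists_commute_of_affine
      (S := {z | z ∈ tangentAlg G ∧ (M * z).trace = (M * y).trace}) hg ⟨y, hy, rfl⟩
      (fun z hz w hw k => ⟨add_mem (Submodule.smul_mem _ _ hz.1) (Submodule.smul_mem _ _ hw.1), by
        rw [mul_add, mul_smul_comm, mul_smul_comm, Matrix.trace_add, Matrix.trace_smul,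
          Matrix.trace_smul, hz.2, hw.2, ← add_smul, add_sub_cancel, one_smul]⟩)
      (fun t ht z hz => ⟨conj_mem_tangentAlg (hT.2.1 ht) hz.1, by
        rw [← mul_assoc, Matrix.trace_mul_comm, ← mul_assoc M, ← (hMT t ht).eq, mul_assoc,
          Units.inv_mul_cancel_left, hz.2]⟩)
    rw [← hzM]
    exact trace_mul_eq_zero_of_isNilpotent hc hs ⟨hM, hMT⟩ hMn ⟨hz, hzT⟩
  rw [hG.traceRadical_eq_bot] at hrad
  exact (Submodule.mem_bot K).1 hrad

end MaximalTorus

section Block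

variable {ι κ : Type} [Fintype ι] [DecidableEq ι] [Fintype κ] [DecidableEq κ]

/-- The embedding of pairs of matrices as block diagonal matrices. -/
def blockHom : (Matrix ι ι K × Matrix κ κ K) →ₐ[K] Matrix (ι ⊕ κ) (ι ⊕ κ) K where
  toFun x := fromBlocks x.1 0 0 x.2
  map_one' := fromBlocks_one
  map_mul' x y := by simp [fromBlocks_multiply]
  map_zero' := fromBlocks_zero
  map_add' x y := by simp [fromBlocks_add]
  commutes' c := by
    ext (i | i) (j | j) <;> simp [Matrix.algebraMap_matrix_apply]

lemma isNilpotent_blockHom {x : Matrix ι ι K} {y : Matrix κ κ K} (hx : IsNilpotent x)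
    (hy : IsNilpotent y) : IsNilpotent (blockHom (x, y)) := by
  obtain ⟨k, hk⟩ := hx
  obtain ⟨l, hl⟩ := hy
  refine IsNilpotent.map (⟨k + l, ?_⟩ : IsNilpotent (x, y)) blockHom
  rw [Prod.pow_mk, pow_add, pow_add, hk, hl, zero_mul, mul_zero]
  rfl

lemma exp_blockHom [CharZero K] {x : Matrix ι ι K} {y : Matrix κ κ K} (hx : IsNilpotent x)
    (hy : IsNilpotent y) :
    IsNilpotent.exp (blockHom (x, y)) = blockHom (IsNilpotent.exp x, IsNilpotent.exp y) := by
  obtain ⟨k, hk⟩ := hx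
  obtain ⟨l, hl⟩ := hy
  have hk' : x ^ (k + l) = 0 := by rw [pow_add, hk, zero_mul]
  have hl' : y ^ (k + l) = 0 := by rw [pow_add, hl, mul_zero]
  have h : (x, y) ^ (k + l) = 0 := by
    rw [Prod.pow_mk, hk', hl']
    rfl
  rw [← IsNilpotent.map_exp ⟨_, h⟩ (blockHom (K := K) (ι := ι) (κ := κ)), IsNilpotent.exp_eq_sum h,
    IsNilpotent.exp_eq_sum hk', IsNilpotent.exp_eq_sum hl']
  congr 1
  simp [Prod.ext_iff, Prod.fst_sum, Prod.snd_sum]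

/-- The embedding of pairs of invertible matrices as block diagonal matrices. -/
def blockGL : GL ι K × GL κ K →* GL (ι ⊕ κ) K :=
  (Units.map (blockHom (K := K) (ι := ι) (κ := κ) : _ →* _)).comp MulEquiv.prodUnits.symm.toMonoidHom

lemma blockGL_val (A : GL ι K) (B : GL κ K) :
    (blockGL (A, B) : Matrix (ι ⊕ κ) (ι ⊕ κ) K) = blockHom ((A : Matrix ι ι K), (B : Matrix κ κ K)) := rfl

lemma blockGL_inv_val (A : GL ι K) (B : GL κ K) :
    ((blockGL (A, B))⁻¹ : GL (ι ⊕ κ) K) =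
     blockGL (A⁻¹, B⁻¹) := by
  rw [← map_inv]; rfl

lemma blockGL_injective : Function.Injective (blockGL (K := K) (ι := ι) (κ := κ)) := by
  rintro ⟨A, B⟩ ⟨A', B'⟩ h
  have := congrArg (fun C : GL (ι ⊕ κ) K => (C : Matrix (ι ⊕ κ) (ι ⊕ κ) K)) h
  obtain ⟨h₁, -, -, h₂⟩ := fromBlocks_inj.1 this
  exact Prod.ext (Units.ext h₁) (Units.ext h₂)

lemma conjDiag_blockGL (g : GL ι K) (g' : GL κ K) (a : ι → K) (a' : κ → K) :
    conjDiag (blockGL (g, g')) (Sum.elim a a') = blockHom (conjDiag g a, conjDiag g' a') := by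
  have : diagonal (Sum.elim a a') = blockHom (diagonal a, diagonal a') :=
    (fromBlocks_diagonal a a').symm
  rw [conjDiag, this, blockGL_inv_val, blockGL_val, blockGL_val, ← map_mul, ← map_mul]
  rfl

lemma matEval_rename_inl (x : Matrix ι ι K) (y : Matrix κ κ K) (p : MvPolynomial (ι × ι) K) :
    matEval (blockHom (x, y)) (rename (Prod.map Sum.inl Sum.inl) p) = matEval x p := by
  rw [matEval, aeval_rename]
  rfl

lemma exists_eq_blockGL {C : GL (ι ⊕ κ) K} (h₁ : ∀ i j, (C : Matrix (ι ⊕ κ) (ι ⊕ κ) K) (Sum.inl i) (Sum.inr j) = 0)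
    (h₂ : ∀ i j, (C : Matrix (ι ⊕ κ) (ι ⊕ κ) K) (Sum.inr i) (Sum.inl j) = 0) :
    ∃ A B, C = blockGL (A, B) := by
  set C' := (C : Matrix (ι ⊕ κ) (ι ⊕ κ) K) with hC'
  have h : C' = fromBlocks C'.toBlocks₁₁ 0 0 C'.toBlocks₂₂ := by
    conv_lhs => rw [← fromBlocks_toBlocks C']
    congr 1
    · exact Matrix.ext h₁
    · exact Matrix.ext h₂
  have hdet := (Matrix.isUnit_iff_isUnit_det _).1 C.isUnit
  rw [← hC', h, det_fromBlocks_zero₂₁, IsUnit.mul_iff, ← Matrix.isUnit_iff_isUnit_det,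
    ← Matrix.isUnit_iff_isUnit_det] at hdet
  obtain ⟨⟨A, hA⟩, B, hB⟩ := hdet
  exact ⟨A, B, Units.ext (by rw [blockGL_val, hA, hB]; exact h)⟩

/-- The graph of a homomorphism, as a group of block diagonal matrices. -/
def graphGL {H : Subgroup (GL ι K)} (f : H →* GL κ K) : Subgroup (GL (ι ⊕ κ) K) :=
  (blockGL.comp (H.subtype.prod f)).range

lemma blockGL_mem_graphGL {H : Subgroup (GL ι K)} {f : H →* GL κ K} {A : GL ι K} {B : GL κ K} :
    blockGL (A, B) ∈ graphGL f ↔ ∃ hA : A ∈ H, f ⟨A, hA⟩ = B := by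
  constructor
  · rintro ⟨C, hC⟩
    have := blockGL_injective hC
    simp only [MonoidHom.prod_apply, Subgroup.subtype_apply, Prod.mk.injEq] at this
    obtain ⟨rfl, rfl⟩ := this
    exact ⟨C.2, rfl⟩
  · rintro ⟨hA, rfl⟩
    exact ⟨⟨A, hA⟩, rfl⟩

end Block

section Graph

variable {n m : ℕ} {H : Subgroup (GL (Fin n) K)} {f : H →* GL (Fin m) K}

lemma isEntryClosed_graphGL (hH : IsEntryClosed H)
    (hf : ∀ i j, IsPolyFun H fun A => (f A : Matrix (Fin m) (Fin m) K) i j) :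
    IsEntryClosed (graphGL f) := by
  intro C hC
  obtain ⟨A, B, rfl⟩ : ∃ A B, C = blockGL (A, B) := by
    refine exists_eq_blockGL (fun i j => ?_) fun i j => ?_
    · have := hC (X (Sum.inl i, Sum.inr j)) ?_
      · rwa [matEval_X] at this
      · rintro _ ⟨D, rfl⟩
        rw [matEval_X]
        rfl
    · have := hC (X (Sum.inr i, Sum.inl j)) ?_
      · rwa [matEval_X] at this
      · rintro _ ⟨D, rfl⟩
        rw [matEval_X]
        rfl
  have hA : A ∈ H := by
    refine hH A fun p hp => ?_
    rw [← matEval_rename_inl _ (B : Matrix (Fin m) (Fin m) K)]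
    refine hC _ ?_
    rintro _ ⟨D, rfl⟩
    exact (matEval_rename_inl _ _ _).trans (hp D D.2)
  refine blockGL_mem_graphGL.2 ⟨hA, Units.ext (Matrix.ext fun i j => ?_)⟩
  obtain ⟨p, hp⟩ := hf i j
  obtain ⟨q, d, hq⟩ := exists_matEval_eq_det_pow_mul p
  have hP : ∀ (A : GL (Fin n) K) (B : GL (Fin m) K),
      matEval (blockGL (A, B) : Matrix (Fin n ⊕ Fin m) (Fin n ⊕ Fin m) K)
        (rename (Prod.map Sum.inl Sum.inl) q - rename (Prod.map Sum.inl Sum.inl)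
          (Matrix.det (Matrix.of fun i j => X (i, j)) ^ d) * X (Sum.inr i, Sum.inr j)) =
        (A : Matrix (Fin n) (Fin n) K).det ^ d *
          (eval (matOf A) p - (B : Matrix (Fin m) (Fin m) K) i j) := by
    intro A B
    rw [map_sub, map_mul, blockGL_val, matEval_rename_inl, matEval_rename_inl, map_pow,
      matEval_det_X, hq, matEval_X, mul_sub]
    rfl
  have h := hC _ fun D hD => by
    obtain ⟨D, rfl⟩ := hD
    exact (hP (D : GL (Fin n) K) (f D)).trans (by rw [← hp, sub_self, mul_zero])
  rw [hP, mul_eq_zero, or_iff_right (pow_ne_zero _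
    ((Matrix.isUnit_iff_isUnit_det _).1 A.isUnit).ne_zero), sub_eq_zero] at h
  exact (hp ⟨A, hA⟩).trans h

end Graph

section Unipotent

variable {n m : ℕ}

/-- The multiplicative Jordan decomposition. -/
lemma exists_conjDiag_mul_unipotent [IsAlgClosed K] {ι : Type} [Fintype ι] [DecidableEq ι] (A : GL ι K) :
    ∃ (g : GL ι K) (a : ι → K) (S W : GL ι K), A = S * W ∧ (S : Matrix ι ι K) = conjDiag g a ∧
      IsNilpotent ((W : Matrix ι ι K) - 1) ∧ Commute S W := by
  obtain ⟨g, a, ν, hA, hν, hc, -⟩ := exists_jordan (A : Matrix ι ι K)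
  have hu : IsUnit (conjDiag g a) := by
    have h := hν.neg.isUnit_add_left_of_commute A.isUnit
      (by rw [hA]; exact (hc.symm.add_right (Commute.refl ν)).neg_left)
    rwa [hA, add_neg_cancel_right] at h
  obtain ⟨S, hS⟩ := hu
  have hcS : Commute (S : Matrix ι ι K) ν := by rw [hS]; exact hc
  have hSA : Commute S A := by
    refine Units.ext ?_
    rw [Units.val_mul, Units.val_mul, hA, ← hS]
    exact (Commute.refl _).add_right hcS
  refine ⟨g, a, S, S⁻¹ * A, (mul_inv_cancel_left S A).symm, hS, ?_,
    ((Commute.refl S).inv_right.mul_right hSA)⟩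
  rw [Units.val_mul, hA, ← hS, mul_add, Units.inv_mul, add_sub_cancel_left]
  exact hcS.units_inv_left.isNilpotent_mul_left hν

/-- A regular homomorphism with unipotent values on a closed subgroup of a reductive group
containing a maximal torus is trivial. -/
lemma IsReductive.eq_one_of_unipotent [IsAlgClosed K] [CharZero K] {G H T : Subgroup (GL (Fin n) K)}
    (hG : IsReductive G) (hHG : H ≤ G) (hH : IsZClosed (H : Set (GL (Fin n) K)))
    (hT : IsMaximalTorus G T) (hTH : T ≤ H) (f : H →* GL (Fin m) K)
    (hf : ∀ i j, IsPolyFun H fun A => (f A : Matrix (Fin m) (Fin m) K) i j)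
    (hfu : ∀ A, IsNilpotent ((f A : Matrix (Fin m) (Fin m) K) - 1)) (A : H) : f A = 1 := by
  have hΓ := isEntryClosed_graphGL hH.isEntryClosed hf
  have hsemi : ∀ {S W : GL (Fin n) K} {u : GL (Fin m) K} {g : GL (Fin n) K} {a : Fin n → K},
      (S : Matrix (Fin n) (Fin n) K) = conjDiag g a →
      IsNilpotent ((W : Matrix (Fin n) (Fin n) K) - 1) →
      IsNilpotent ((u : Matrix (Fin m) (Fin m) K) - 1) → Commute S W →
      blockGL (S * W, u) ∈ graphGL f → blockGL (S, 1) ∈ graphGL f := by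
    intro S W u g a hS hW hu hSW h
    refine semisimple_factor_mem hΓ (g := blockGL (g, 1)) (a := Sum.elim a fun _ => 1)
      (W := blockGL (W, u)) ?_ ?_ ?_ ?_
    · rw [conjDiag_blockGL, conjDiag_one, ← hS, blockGL_val, Units.val_one]
    · rw [blockGL_val, ← map_one (blockHom (K := K) (ι := Fin n) (κ := Fin m)), ← map_sub]
      exact isNilpotent_blockHom hW hu
    · exact (Prod.commute_iff.2 ⟨hSW, Commute.one_left u⟩).map blockGL
    · rw [← map_mul, Prod.mk_mul_mk, one_mul]
      exact h
  obtain ⟨g₀, hg₀⟩ := hT.1.exists_conjDiag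
  have hTΓ : ∀ t ∈ T, blockGL (t, 1) ∈ graphGL f := by
    intro t ht
    obtain ⟨a, ha⟩ := hg₀ t ht
    refine hsemi (W := 1) ha (by simp) (hfu ⟨t, hTH ht⟩) (Commute.one_right t) ?_
    rw [mul_one]
    exact blockGL_mem_graphGL.2 ⟨_, rfl⟩
  obtain ⟨g, a, S, W, hA, hS, hW, hSW⟩ := exists_conjDiag_mul_unipotent (A : GL (Fin n) K)
  have hAΓ : blockGL (S * W, f A) ∈ graphGL f := by
    rw [← hA]
    exact blockGL_mem_graphGL.2 ⟨A.2, rfl⟩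
  have hWΓ : blockGL (W, f A) ∈ graphGL f := by
    have h := mul_mem (inv_mem (hsemi hS hW (hfu A) hSW hAΓ)) hAΓ
    rwa [← map_inv, ← map_mul, Prod.inv_mk, Prod.mk_mul_mk, inv_mul_cancel_left, inv_one,
      one_mul] at h
  obtain ⟨N, hN, hNW⟩ := exists_exp_eq hW
  obtain ⟨ν, hν, hνA⟩ := exists_exp_eq (hfu A)
  have hNν : blockHom (N, ν) ∈ tangentAlg (graphGL f) := by
    refine mem_tangentAlg_of_exp_mem (isNilpotent_blockHom hN hν) ?_ hWΓ
    rw [exp_blockHom hN hν, hNW, hνA, blockGL_val]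
  obtain ⟨y, hyν, hyT⟩ := exists_commute_of_affine
    (S := {y | blockHom (y, ν) ∈ tangentAlg (graphGL f)}) hg₀ ⟨N, hNν⟩
    (fun y hy z hz c => by
      rw [Set.mem_ofPred_eq] at hy hz ⊢
      have h := add_mem (Submodule.smul_mem _ c hy) (Submodule.smul_mem _ (1 - c) hz)
      rwa [← map_smul, ← map_smul, ← map_add, Prod.smul_mk, Prod.smul_mk, Prod.mk_add_mk,
        ← add_smul, add_sub_cancel, one_smul] at h)
    (fun t ht y hy => by
      rw [Set.mem_ofPred_eq] at hy ⊢
      have h := conj_mem_tangentAlg (hTΓ t ht) hy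
      rwa [blockGL_inv_val, blockGL_val, blockGL_val, ← map_mul, ← map_mul, Prod.mk_mul_mk,
        Prod.mk_mul_mk, inv_one, Units.val_one, one_mul, mul_one] at h)
  obtain ⟨g', a', M, rfl, hM, hcM, hcomm⟩ := exists_jordan y
  have hsplit : blockHom (conjDiag g' a' + M, ν) =
      conjDiag (blockGL (g', 1)) (Sum.elim a' fun _ => 0) + blockHom (M, ν) := by
    rw [conjDiag_blockGL, conjDiag_zero, ← map_add, Prod.mk_add_mk, zero_add]
  have hMν : blockHom (M, ν) ∈ tangentAlg (graphGL f) := by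
    rw [Set.mem_ofPred_eq, hsplit] at hyν
    have h := conjDiag_mem_tangentAlg (isNilpotent_blockHom hM hν) (by
      rw [conjDiag_blockGL, conjDiag_zero]
      exact (Prod.commute_iff.2 ⟨hcM, Commute.zero_left ν⟩).map blockHom) hyν fun _ _ h => h
    exact (Submodule.add_mem_iff_right _ h).1 hyν
  obtain ⟨B, hB⟩ := exists_unit_eq_exp hM
  obtain ⟨hBH, hBA⟩ : ∃ hB : B ∈ H, f ⟨B, hB⟩ = f A := by
    refine blockGL_mem_graphGL.1 (exp_mem_of_mem_tangentAlg hΓ (isNilpotent_blockHom hM hν) hMν ?_)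
    rw [exp_blockHom hM hν, hνA, ← hB, blockGL_val]
  have hM0 : M = 0 := hG.eq_zero_of_commute hT (mem_tangentAlg_of_exp_mem hM hB (hHG hBH)) hM
    fun t ht => by
      have h := (hyT t ht).sub_right (hcomm _ (hyT t ht))
      rwa [add_sub_cancel_left] at h
  have hB1 : (⟨B, hBH⟩ : H) = 1 := by
    refine Subtype.ext (Units.ext ?_)
    rw [hB, hM0, IsNilpotent.exp_zero]
    rfl
  rw [← hBA, hB1, map_one]

end Unipotent

/-- Lemma 2.3.6. Over an algebraically closed field of characteristic 0,
if `H` is a closed subgroup of a reductive group `G` of maximal reductive rank (i.e. containing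
a maximal torus of `G`), then every homomorphism of algebraic groups from `H` to a unipotent
algebraic group is trivial. -/
theorem hom_to_unipotent_trivial_of_maximal_rank
    {K : Type} [Field K] [IsAlgClosed K] [CharZero K] {n : ℕ}
    (G H : Subgroup (GL (Fin n) K)) (hG : IsReductive G) (hHG : H ≤ G)
    (hHcl : IsZClosed (H : Set (GL (Fin n) K)))
    (hT : ∃ T : Subgroup (GL (Fin n) K), IsMaximalTorus G T ∧ T ≤ H)
    {m : ℕ} (U : Subgroup (GL (Fin m) K))
    (hUcl : IsZClosed (U : Set (GL (Fin m) K)))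
    (hU : ∀ u ∈ U, IsUnipotentElt u)
    (φ : AlgGroupHom H U) : ∀ A : H, φ.toFun A = 1 := by
  obtain ⟨T, hT, hTH⟩ := hT
  intro A
  exact Subtype.ext (hG.eq_one_of_unipotent hHG hHcl hT hTH (U.subtype.comp φ.toFun) φ.poly
    (fun A => ⟨m, hU _ (φ.toFun A).2⟩) A)
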